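/- arXiv:2505.04315 — 13 statements merged into one kernel-verified Lean document; each statement's English description precedes it below -/
import Mathlib

section
/- Let p be a prime, q = p^s with s ≥ 1, let m ≥ 1 and h ≥ 0 be integers, and let F be a finite field with q^{2m} elements. Then the following are equivalent: (i) there exist pairwise distinct x, y, z ∈ F with x^{q^m+1} = y^{q^m+1} = z^{q^m+1} = 1 and nonzero elements i, j, k ∈ F satisfying i^q = i, j^q = j, k^q = k, such that i·x^h + j·y^h + k·z^h = 0 and i·x^{h+1} + j·y^{h+1} + k·z^{h+1} = 0; (ii) gcd(2h+1, gcd(q+1, q^m+1)) ≠ 1. -/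
section
variable {K : Type*} [Field K]

/-- Eliminating the first term from two linear relations and their conjugates. -/
lemma sq_mul_eq_one_of_conj_relations {i j k P R X Y : K} (hj : j ≠ 0) (hP : P ≠ 0) (hR : R ≠ 0)
    (hX : X ≠ 0) (hY : Y ≠ 0) (hXY : X ≠ Y)
    (h₁ : i * P + j * R + k = 0) (h₂ : i * (P * X) + j * (R * Y) + k = 0)
    (h₃ : i * P⁻¹ + j * R⁻¹ + k = 0) (h₄ : i * (P * X)⁻¹ + j * (R * Y)⁻¹ + k = 0) :
    R ^ 2 * Y = 1 := by
  have e₃ : i * R + j * P + k * (P * R) = 0 := by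
    field_simp at h₃
    linear_combination h₃
  have e₄ : i * (R * Y) + j * (P * X) + k * (P * X * (R * Y)) = 0 := by
    field_simp at h₄
    linear_combination h₄
  have e : P * (j * (Y - X) * (1 - R ^ 2 * Y)) = 0 := by
    linear_combination P * R * Y * (X * h₁ - h₂) + (Y * e₃ - e₄)
  have : 1 - R ^ 2 * Y = 0 := by
    simpa [hP, hj, sub_eq_zero, hXY.symm] using e
  linear_combination -this

/-- Relations between two elements of norm one force `b = Y ^ (h + 1)` to be a `(2 * h + 1)`-th
root of unity, and `b + b⁻¹` to be given by the law of cosines. -/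
lemma law_of_cosines_of_conj_relations (σ : K →+* K) {i j k X Y : K} (h : ℕ)
    (hi : i ≠ 0) (hj : j ≠ 0) (hX : X * σ X = 1) (hY : Y * σ Y = 1) (hXY : X ≠ Y)
    (σi : σ i = i) (σj : σ j = j) (σk : σ k = k)
    (h₁ : i * X ^ h + j * Y ^ h + k = 0) (h₂ : i * X ^ (h + 1) + j * Y ^ (h + 1) + k = 0) :
    Y ^ (2 * h + 1) = 1 ∧
      i ^ 2 = j ^ 2 + k ^ 2 + k * j * (Y ^ (h + 1) + (Y ^ (h + 1))⁻¹) := by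
  have hX0 : X ≠ 0 := left_ne_zero_of_mul_eq_one hX
  have hY0 : Y ≠ 0 := left_ne_zero_of_mul_eq_one hY
  have σX : σ X = X⁻¹ := eq_inv_of_mul_eq_one_right hX
  have σY : σ Y = Y⁻¹ := eq_inv_of_mul_eq_one_right hY
  have h₃ := congrArg σ h₁
  have h₄ := congrArg σ h₂
  simp only [map_add, map_mul, map_pow, σi, σj, σk, σX, σY, map_zero, inv_pow] at h₃ h₄
  have hR : (Y ^ h) ^ 2 * Y = 1 := by
    simp only [pow_succ _ h] at h₂ h₄
    exact sq_mul_eq_one_of_conj_relations hj (pow_ne_zero h hX0) (pow_ne_zero h hY0) hX0 hY0 hXY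
      h₁ h₂ h₃ h₄
  have hP : (X ^ h) ^ 2 * X = 1 := by
    simp only [pow_succ _ h] at h₂ h₄
    rw [add_comm (i * _)] at h₁ h₂ h₃ h₄
    exact sq_mul_eq_one_of_conj_relations hi (pow_ne_zero h hY0) (pow_ne_zero h hX0) hY0 hX0
      hXY.symm h₁ h₂ h₃ h₄
  have hX' : X ^ (h + 1) * X ^ h = 1 := by rw [← hP]; ring
  have hY' : Y ^ (h + 1) * Y ^ h = 1 := by rw [← hR]; ring
  refine ⟨by rw [← hR]; ring, ?_⟩
  rw [inv_eq_of_mul_eq_one_right hY']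
  linear_combination (i * X ^ h) * h₂ - (j * Y ^ (h + 1) + k) * h₁ - i ^ 2 * hX' + j ^ 2 * hY'

/-- An element whose trace `b + b⁻¹` is fixed by `σ` is sent by `σ` to itself or its inverse. -/
lemma map_eq_self_or_inv_of_map_add_inv (σ : K →+* K) {b : K} (hb : b ≠ 0)
    (hσ : σ (b + b⁻¹) = b + b⁻¹) : σ b = b ∨ σ b * b = 1 := by
  have hb' : σ b ≠ 0 := (map_ne_zero σ).2 hb
  rw [map_add, map_inv₀] at hσ
  field_simp at hσ
  have : (σ b - b) * (σ b * b - 1) = 0 := by linear_combination hσ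
  simpa [sub_eq_zero] using this

end

lemma pow_fixed_of_pow_fixed {M : Type*} [Monoid M] {a : M} {q : ℕ} (ha : a ^ q = a) (m : ℕ) :
    a ^ q ^ m = a := by
  induction m with
  | zero => simp
  | succ m ih => rw [pow_succ, pow_mul, ih, ha]

lemma exists_orderOf_eq_of_dvd_card_sub_one {K : Type*} [Field K] [Fintype K] {r : ℕ}
    (hr : r.Prime) (hd : r ∣ Fintype.card K - 1) : ∃ a : K, orderOf a = r := by
  classical
  have := Fact.mk hr
  obtain ⟨u, hu⟩ := exists_prime_orderOf_dvd_card (G := Kˣ) r (by rwa [Fintype.card_units])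
  exact ⟨u, by rw [orderOf_units, hu]⟩

theorem stmt_2 (p : ℕ) (hp : Nat.Prime p) (s m h : ℕ) (hs : 1 ≤ s) (hm : 1 ≤ m)
    (q : ℕ) (hq : q = p ^ s)
    (F : Type*) [Field F] [Fintype F] (hF : Fintype.card F = q ^ (2 * m)) :
    (∃ x y z : F, x ≠ y ∧ x ≠ z ∧ y ≠ z ∧
      x ^ (q ^ m + 1) = 1 ∧ y ^ (q ^ m + 1) = 1 ∧ z ^ (q ^ m + 1) = 1 ∧
      ∃ i j k : F, i ≠ 0 ∧ j ≠ 0 ∧ k ≠ 0 ∧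
        i ^ q = i ∧ j ^ q = j ∧ k ^ q = k ∧
        i * x ^ h + j * y ^ h + k * z ^ h = 0 ∧
        i * x ^ (h + 1) + j * y ^ (h + 1) + k * z ^ (h + 1) = 0) ↔
    Nat.gcd (2 * h + 1) (Nat.gcd (q + 1) (q ^ m + 1)) ≠ 1 := by
  have := Fact.mk hp
  have hchar : CharP F p := charP_of_card_eq_prime_pow (f := s * (2 * m)) (by
    rw [hF, hq, ← pow_mul])
  let φ : F →+* F := iterateFrobenius F p s
  have hφ (a : F) : φ a = a ^ q := by rw [hq]; exact iterateFrobenius_def p s a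
  let ψ : F →+* F := iterateFrobenius F p (s * m)
  have hψ (a : F) : ψ a = a ^ q ^ m := by
    rw [hq, ← pow_mul]; exact iterateFrobenius_def p (s * m) a
  constructor
  · rintro ⟨x, y, z, hxy, hxz, hyz, hx, hy, hz, i, j, k, hi, hj, hk, hiq, hjq, hkq, h₁, h₂⟩
    have hz0 : z ≠ 0 := by rintro rfl; simp at hz
    have hconj {w : F} (hw : w ^ (q ^ m + 1) = 1) : (w / z) * ψ (w / z) = 1 := by
      rw [hψ, ← pow_succ', div_pow, hw, hz, div_one]
    obtain ⟨hY, hcos⟩ := law_of_cosines_of_conj_relations ψ (i := i) (j := j) (k := k)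
      (X := x / z) (Y := y / z) h hi hj (hconj hx) (hconj hy)
      (fun e => hxy ((div_left_inj' hz0).1 e))
      (by rw [hψ, pow_fixed_of_pow_fixed hiq]) (by rw [hψ, pow_fixed_of_pow_fixed hjq])
      (by rw [hψ, pow_fixed_of_pow_fixed hkq])
      (by simp only [div_pow]; field_simp; linear_combination h₁)
      (by simp only [div_pow]; field_simp; linear_combination h₂)
    have hYU := hconj hy
    have hY1 : y / z ≠ 1 := fun e => hyz ((div_eq_one_iff_eq hz0).1 e)
    generalize y / z = Y at hY hcos hYU hY1
    rw [hψ, ← pow_succ'] at hYU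
    have hY0 : Y ≠ 0 := by rintro rfl; simp at hYU
    set b := Y ^ (h + 1) with hb
    have hb0 : b ≠ 0 := pow_ne_zero _ hY0
    have hbY : b ^ 2 = Y := by
      rw [hb, ← pow_mul, show (h + 1) * 2 = (2 * h + 1) + 1 by ring, pow_succ, hY, one_mul]
    have hbh : b ^ (2 * h + 1) = 1 := by rw [hb, pow_right_comm, hY, one_pow]
    have hbU : b ^ (q ^ m + 1) = 1 := by rw [hb, pow_right_comm, hYU, one_pow]
    have hb1 : b ≠ 1 := fun e => hY1 (by rw [← hbY, e, one_pow])
    have htrace : b + b⁻¹ = (i ^ 2 - j ^ 2 - k ^ 2) / (k * j) := by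
      rw [eq_div_iff (mul_ne_zero hk hj)]
      linear_combination -hcos
    have hbq : b ^ q * b = 1 := by
      have hfix : φ (b + b⁻¹) = b + b⁻¹ := by
        rw [htrace]
        simp only [map_div₀, map_sub, map_mul, map_pow]
        rw [hφ i, hφ j, hφ k, hiq, hjq, hkq]
      rcases map_eq_self_or_inv_of_map_add_inv φ hb0 hfix with e | e
      · rw [hφ] at e
        refine absurd ?_ hY1
        rw [← hbY, sq, ← hbU, pow_succ, pow_fixed_of_pow_fixed e]
      · rwa [hφ] at e
    rw [← pow_succ] at hbq
    intro hgcd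
    have hord : orderOf b ∣ 1 := hgcd ▸ Nat.dvd_gcd (orderOf_dvd_of_pow_eq_one hbh)
      (Nat.dvd_gcd (orderOf_dvd_of_pow_eq_one hbq) (orderOf_dvd_of_pow_eq_one hbU))
    exact hb1 (orderOf_eq_one_iff.1 (Nat.dvd_one.1 hord))
  · intro hgcd
    obtain ⟨r, hr, hrd⟩ := Nat.exists_prime_and_dvd hgcd
    have hrh : r ∣ 2 * h + 1 := hrd.trans (Nat.gcd_dvd_left _ _)
    have hrq : r ∣ q + 1 := hrd.trans ((Nat.gcd_dvd_right _ _).trans (Nat.gcd_dvd_left _ _))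
    have hrQ : r ∣ q ^ m + 1 := hrd.trans ((Nat.gcd_dvd_right _ _).trans (Nat.gcd_dvd_right _ _))
    have hcard : r ∣ Fintype.card F - 1 := by
      have : q ^ (2 * m) - 1 = (q ^ m + 1) * (q ^ m - 1) := by
        rw [← Nat.sq_sub_sq, mul_comm 2 m, pow_mul, one_pow]
      rw [hF, this]
      exact hrQ.mul_right _
    obtain ⟨a, ha⟩ := exists_orderOf_eq_of_dvd_card_sub_one hr hcard
    have hpow {n : ℕ} (hn : r ∣ n) : a ^ n = 1 := orderOf_dvd_iff_pow_eq_one.1 (ha ▸ hn)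
    have hah := hpow hrh
    have haq := hpow hrq
    have haQ := hpow hrQ
    have ha0 : a ≠ 0 := by rintro rfl; simp at haq
    have ha1 : a ≠ 1 := by
      rintro rfl
      rw [orderOf_one] at ha
      exact hr.ne_one ha.symm
    have hr2 : Nat.Coprime r 2 := by
      rw [Nat.coprime_primes hr Nat.prime_two]
      rintro rfl
      omega
    have ha2 : a ^ 2 ≠ 1 := fun e => hr.ne_one
      (hr2.eq_one_of_dvd (ha ▸ orderOf_dvd_of_pow_eq_one e))
    have ha4 : a ^ 4 ≠ 1 := fun e => hr.ne_one
      ((hr2.pow_right 2).eq_one_of_dvd (ha ▸ orderOf_dvd_of_pow_eq_one e))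
    have hconj : a ^ q = a⁻¹ := eq_inv_of_mul_eq_one_left (by rw [← pow_succ, haq])
    have hhalf : (a ^ 2) ^ h = a⁻¹ :=
      eq_inv_of_mul_eq_one_left (by rw [← pow_mul, ← pow_succ, hah])
    refine ⟨a ^ 2, (a ^ 2)⁻¹, 1, ?_, ha2, by simpa using ha2, by rw [pow_right_comm, haQ, one_pow],
      by rw [inv_pow, pow_right_comm, haQ, one_pow, inv_one], one_pow _,
      1, 1, -(a + a⁻¹), one_ne_zero, one_ne_zero, ?_, one_pow _, one_pow _, ?_, ?_, ?_⟩
    · intro e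
      have := mul_inv_cancel₀ (pow_ne_zero 2 ha0)
      rw [← e] at this
      exact ha4 (by rw [← this]; ring)
    · intro e
      have e' : a ^ 2 + 1 = 0 := by
        field_simp at e
        linear_combination -e
      exact ha4 (by linear_combination (a ^ 2 - 1) * e')
    · rw [← hφ, map_neg, map_add, map_inv₀, hφ, hconj, inv_inv, add_comm]
    · rw [inv_pow, hhalf, inv_inv, one_pow]
      ring
    · rw [pow_succ _ h, pow_succ _ h, inv_pow, hhalf, inv_inv, one_pow]
      field_simp
      ring
end

section
/- Let p be a prime, q = p^s with s ≥ 1, let m ≥ 1 be odd and h ≥ 0 an integer with gcd(2h+1, q+1) = 1, and let F be a finite field with q^{2m} elements. Suppose x, y, z, w ∈ F are pairwise distinct with x^{q+1} = y^{q+1} = z^{q+1} = w^{q+1} = 1 and E(x,z)·E(y,w) = E(y,z)·E(x,w), where E(a,b) = (a^{2h+1} − b^{2h+1})/(a − b). Then there exist nonzero i, j, k, l ∈ F satisfying i^q = i, j^q = j, k^q = k, l^q = l such that i·x^h + j·y^h + k·z^h + l·w^h = 0 and i·x^{h+1} + j·y^{h+1} + k·z^{h+1} + l·w^{h+1} = 0.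 -/
theorem pow_ne_pow_of_coprime {F : Type*} [Field F] {n N : ℕ} (hg : Nat.gcd n N = 1)
    {a b : F} (hb0 : b ≠ 0) (ha : a ^ N = 1) (hb : b ^ N = 1) (hab : a ≠ b) :
    a ^ n ≠ b ^ n := by
  intro e
  have h1 : (a / b) ^ n = 1 := by rw [div_pow, e, div_self (pow_ne_zero _ hb0)]
  have h2 : (a / b) ^ N = 1 := by rw [div_pow, ha, hb, div_one]
  have h3 : (a / b) ^ Nat.gcd n N = 1 := pow_gcd_eq_one.2 ⟨h1, h2⟩
  rw [hg, pow_one, div_eq_one_iff_eq hb0] at h3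
  exact hab h3

/-- If `A, B, C, D` have the same cross-ratio as `a, b, c, d`, then `(A, B, C, D)` and
`(a * A, b * B, c * C, d * D)` satisfy a common explicit linear relation. -/
theorem linear_relation_of_cross_ratio_eq {F : Type*} [Field F] {a b c d A B C D : F}
    (had : a ≠ d) (hbd : b ≠ d) (hcd : c ≠ d) (hCD : C ≠ D)
    (hE : (A - C) * (B - D) * ((b - c) * (a - d)) = (B - C) * (A - D) * ((a - c) * (b - d))) :
    (B - C) / (a - d) * A + (C - A) / (b - d) * B + (A - B) / (c - d) * C
        + (B - C) * (A - C) * (a - b) / ((D - C) * (a - d) * (b - d)) * D = 0 ∧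
    (B - C) / (a - d) * (a * A) + (C - A) / (b - d) * (b * B) + (A - B) / (c - d) * (c * C)
        + (B - C) * (A - C) * (a - b) / ((D - C) * (a - d) * (b - d)) * (d * D) = 0 := by
  have h1 := sub_ne_zero.2 had
  have h2 := sub_ne_zero.2 hbd
  have h3 := sub_ne_zero.2 hcd
  have h4 := sub_ne_zero.2 hCD.symm
  constructor
  · field_simp
    linear_combination (-C) * hE
  · field_simp
    linear_combination (-(d * C)) * hE

theorem map_weight {F : Type*} [Field F] (f : F →+* F) {a d t B C : F} (ha : a ≠ 0) (hd : d ≠ 0)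
    (ht : t ≠ 0) (hB : B ≠ 0) (hC : C ≠ 0) (had : a ≠ d)
    (fa : f a = a⁻¹) (fd : f d = d⁻¹) (ft : f t = t⁻¹) (fB : f B = B⁻¹) (fC : f C = C⁻¹) :
    f (t * a * ((B - C) / (a - d))) =
      d / (t ^ 2 * a * B * C) * (t * a * ((B - C) / (a - d))) := by
  have h1 := sub_ne_zero.2 had
  simp only [map_mul, map_div₀, map_sub, fa, fd, ft, fB, fC]
  rw [inv_sub_inv hB hC, inv_sub_inv ha hd, ← neg_sub B C, ← neg_sub a d]
  field_simp

theorem map_last_weight {F : Type*} [Field F] (f : F →+* F) {a b d t A B C : F} (ha : a ≠ 0)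
    (hb : b ≠ 0) (hd : d ≠ 0) (ht : t ≠ 0) (hA : A ≠ 0) (hB : B ≠ 0) (hC : C ≠ 0)
    (had : a ≠ d) (hbd : b ≠ d) (hCD : C ≠ t ^ 2 * d)
    (fa : f a = a⁻¹) (fb : f b = b⁻¹) (fd : f d = d⁻¹) (ft : f t = t⁻¹)
    (fA : f A = A⁻¹) (fB : f B = B⁻¹) (fC : f C = C⁻¹) :
    f (t * d * ((B - C) * (A - C) * (a - b) / ((t ^ 2 * d - C) * (a - d) * (b - d)))) =
      d / (A * B * C) *
        (t * d * ((B - C) * (A - C) * (a - b) / ((t ^ 2 * d - C) * (a - d) * (b - d)))) := by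
  have h4 := sub_ne_zero.2 hCD.symm
  have h5 := sub_ne_zero.2 had
  have h6 := sub_ne_zero.2 hbd
  have hD : t ^ 2 * d ≠ 0 := mul_ne_zero (pow_ne_zero 2 ht) hd
  have fD : f (t ^ 2 * d) = (t ^ 2 * d)⁻¹ := by rw [map_mul, map_pow, fd, ft, mul_inv, inv_pow]
  have hmap : f ((B - C) * (A - C) * (a - b) / ((t ^ 2 * d - C) * (a - d) * (b - d))) =
      (B⁻¹ - C⁻¹) * (A⁻¹ - C⁻¹) * (a⁻¹ - b⁻¹) /
        (((t ^ 2 * d)⁻¹ - C⁻¹) * (a⁻¹ - d⁻¹) * (b⁻¹ - d⁻¹)) := by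
    rw [map_div₀, map_mul, map_mul, map_mul, map_mul, map_sub, map_sub, map_sub, map_sub,
      map_sub, map_sub, fD, fa, fb, fd, fA, fB, fC]
  rw [map_mul, map_mul, hmap, ft, fd, inv_sub_inv hB hC, inv_sub_inv hA hC, inv_sub_inv ha hb,
    inv_sub_inv hD hC, inv_sub_inv ha hd, inv_sub_inv hb hd, ← neg_sub B C, ← neg_sub A C,
    ← neg_sub a b, ← neg_sub (t ^ 2 * d) C, ← neg_sub a d, ← neg_sub b d]
  field_simp

theorem pow_eq_self_of_common_multiplier {M : Type*} [Field M] {n : ℕ} {K i j : M}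
    (hK : K ≠ 0) (hi : i ^ n = K * i) (hj : j ^ n = K * j) : (j / i) ^ n = j / i := by
  rw [div_pow, hi, hj, mul_div_mul_left _ _ hK]


theorem stmt_5 (p : ℕ) (hp : Nat.Prime p) (s m h : ℕ) (hs : 1 ≤ s) (hm : Odd m)
    (hm1 : 1 ≤ m) (q : ℕ) (hq : q = p ^ s) (hgcd : Nat.gcd (2 * h + 1) (q + 1) = 1)
    (F : Type*) [Field F] [Fintype F] (hF : Fintype.card F = q ^ (2 * m))
    (x y z w : F)
    (hxy : x ≠ y) (hxz : x ≠ z) (hxw : x ≠ w) (hyz : y ≠ z) (hyw : y ≠ w) (hzw : z ≠ w)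
    (hx : x ^ (q + 1) = 1) (hy : y ^ (q + 1) = 1)
    (hz : z ^ (q + 1) = 1) (hw : w ^ (q + 1) = 1)
    (hE : ((x ^ (2 * h + 1) - z ^ (2 * h + 1)) / (x - z)) *
            ((y ^ (2 * h + 1) - w ^ (2 * h + 1)) / (y - w)) =
          ((y ^ (2 * h + 1) - z ^ (2 * h + 1)) / (y - z)) *
            ((x ^ (2 * h + 1) - w ^ (2 * h + 1)) / (x - w))) :
    ∃ i j k l : F, i ≠ 0 ∧ j ≠ 0 ∧ k ≠ 0 ∧ l ≠ 0 ∧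
      i ^ q = i ∧ j ^ q = j ∧ k ^ q = k ∧ l ^ q = l ∧
      i * x ^ h + j * y ^ h + k * z ^ h + l * w ^ h = 0 ∧
      i * x ^ (h + 1) + j * y ^ (h + 1) + k * z ^ (h + 1) + l * w ^ (h + 1) = 0 := by
  
  have hprime : Fact p.Prime := ⟨hp⟩
  have hchar : CharP F p := by
    refine charP_of_card_eq_prime_pow (f := s * (2 * m)) ?_
    rw [hF, hq, ← pow_mul]
  set u := 2 * h + 1 with hu
  have inv_of {a : F} (ha : a ^ (q + 1) = 1) : a ^ q = a⁻¹ :=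
    eq_inv_of_mul_eq_one_left (by rwa [← pow_succ])
  have ne_of {a : F} (ha : a ^ (q + 1) = 1) : a ≠ 0 := by
    rintro rfl
    simp at ha
  let f : F →+* F := iterateFrobenius F p s
  have hf (a : F) : f a = a ^ q := by rw [hq]; exact iterateFrobenius_def p s a
  have fpow {a : F} (ha : a ^ (q + 1) = 1) (n : ℕ) : f (a ^ n) = (a ^ n)⁻¹ := by
    rw [map_pow, hf, inv_of ha, inv_pow]
  have f1 {a : F} (ha : a ^ (q + 1) = 1) : f a = a⁻¹ := by rw [hf, inv_of ha]
  have hx0 := ne_of hx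
  have hy0 := ne_of hy
  have hz0 := ne_of hz
  have hw0 := ne_of hw
  have hXY := pow_ne_pow_of_coprime hgcd hy0 hx hy hxy
  have hXZ := pow_ne_pow_of_coprime hgcd hz0 hx hz hxz
  have hYZ := pow_ne_pow_of_coprime hgcd hz0 hy hz hyz
  have hZW := pow_ne_pow_of_coprime hgcd hw0 hz hw hzw
  have hp2 (a : F) : a ^ u = (a ^ h) ^ 2 * a := by rw [hu]; ring
  have hcross : (x ^ u - z ^ u) * (y ^ u - w ^ u) * ((y - z) * (x - w)) =
      (y ^ u - z ^ u) * (x ^ u - w ^ u) * ((x - z) * (y - w)) := by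
    have h1 := sub_ne_zero.2 hxz
    have h2 := sub_ne_zero.2 hyw
    have h3 := sub_ne_zero.2 hyz
    have h4 := sub_ne_zero.2 hxw
    field_simp at hE
    linear_combination hE
  obtain ⟨e1, e2⟩ := linear_relation_of_cross_ratio_eq hxw hyw hzw hZW hcross
  set K := w / (x ^ u * y ^ u * z ^ u) with hK
  have hK0 : K ≠ 0 := div_ne_zero hw0
    (mul_ne_zero (mul_ne_zero (pow_ne_zero u hx0) (pow_ne_zero u hy0)) (pow_ne_zero u hz0))
  set cx := (y ^ u - z ^ u) / (x - w) with hcx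
  set cy := (z ^ u - x ^ u) / (y - w) with hcy
  set cz := (x ^ u - y ^ u) / (z - w) with hcz
  set cw := (y ^ u - z ^ u) * (x ^ u - z ^ u) * (x - y) / ((w ^ u - z ^ u) * (x - w) * (y - w))
    with hcw
  have wx : (x ^ h * x * cx) ^ q = K * (x ^ h * x * cx) := by
    rw [← hf, hcx, map_weight f hx0 hw0 (pow_ne_zero h hx0) (pow_ne_zero u hy0)
      (pow_ne_zero u hz0) hxw (f1 hx) (f1 hw) (fpow hx h) (fpow hy u) (fpow hz u), ← hp2]
  have wy : (y ^ h * y * cy) ^ q = K * (y ^ h * y * cy) := by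
    rw [← hf, hcy, map_weight f hy0 hw0 (pow_ne_zero h hy0) (pow_ne_zero u hz0)
      (pow_ne_zero u hx0) hyw (f1 hy) (f1 hw) (fpow hy h) (fpow hz u) (fpow hx u), ← hp2, hK]
    congr 2
    ring
  have wz : (z ^ h * z * cz) ^ q = K * (z ^ h * z * cz) := by
    rw [← hf, hcz, map_weight f hz0 hw0 (pow_ne_zero h hz0) (pow_ne_zero u hx0)
      (pow_ne_zero u hy0) hzw (f1 hz) (f1 hw) (fpow hz h) (fpow hx u) (fpow hy u), ← hp2, hK]
    congr 2
    ring
  have ww : (w ^ h * w * cw) ^ q = K * (w ^ h * w * cw) := by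
    rw [← hf, hcw, hp2 w, map_last_weight f hx0 hy0 hw0 (pow_ne_zero h hw0) (pow_ne_zero u hx0)
      (pow_ne_zero u hy0) (pow_ne_zero u hz0) hxw hyw (by rwa [← hp2]) (f1 hx) (f1 hy) (f1 hw)
      (fpow hw h) (fpow hx u) (fpow hy u) (fpow hz u)]
  have cx0 : cx ≠ 0 := div_ne_zero (sub_ne_zero.2 hYZ) (sub_ne_zero.2 hxw)
  have cy0 : cy ≠ 0 := div_ne_zero (sub_ne_zero.2 hXZ.symm) (sub_ne_zero.2 hyw)
  have cz0 : cz ≠ 0 := div_ne_zero (sub_ne_zero.2 hXY) (sub_ne_zero.2 hzw)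
  have cw0 : cw ≠ 0 := div_ne_zero
    (mul_ne_zero (mul_ne_zero (sub_ne_zero.2 hYZ) (sub_ne_zero.2 hXZ)) (sub_ne_zero.2 hxy))
    (mul_ne_zero (mul_ne_zero (sub_ne_zero.2 hZW.symm) (sub_ne_zero.2 hxw)) (sub_ne_zero.2 hyw))
  have weight_ne {a c : F} (ha : a ≠ 0) (hc : c ≠ 0) : a ^ h * a * c ≠ 0 :=
    mul_ne_zero (mul_ne_zero (pow_ne_zero h ha) ha) hc
  have hx' := weight_ne hx0 cx0
  refine ⟨_, _, _, _, div_ne_zero hx' hx', div_ne_zero (weight_ne hy0 cy0) hx',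
    div_ne_zero (weight_ne hz0 cz0) hx', div_ne_zero (weight_ne hw0 cw0) hx',
    pow_eq_self_of_common_multiplier hK0 wx wx, pow_eq_self_of_common_multiplier hK0 wx wy,
    pow_eq_self_of_common_multiplier hK0 wx wz, pow_eq_self_of_common_multiplier hK0 wx ww, ?_, ?_⟩
  · simp only [hp2 x, hp2 y, hp2 z, hp2 w] at e1
    linear_combination (x ^ h * x * cx)⁻¹ * e1
  · simp only [hp2 x, hp2 y, hp2 z, hp2 w] at e2
    linear_combination (x ^ h * x * cx)⁻¹ * e2
end

section
/- Let p be an odd prime, q = p^s with s ≥ 1, let m ≥ 1 be odd, let h ≥ 0 be an integer with gcd(2h+1, q+1) = 1, and let F be a finite field with q^{2m} elements. Then: (a) there exist pairwise distinct x, y, z, w ∈ F with x^{q^m+1} = y^{q^m+1} = z^{q^m+1} = w^{q^m+1} = 1 and nonzero i, j, k, l ∈ F satisfying i^q = i, j^q = j, k^q = k, l^q = l such that i·x^h + j·y^h + k·z^h + l·w^h = 0 and i·x^{h+1} + j·y^{h+1} + k·z^{h+1} + l·w^{h+1} = 0; and (b) there do not exist pairwise distinct x, y, z ∈ F with x^{q^m+1}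 = y^{q^m+1} = z^{q^m+1} = 1 and nonzero i, j, k ∈ F satisfying i^q = i, j^q = j, k^q = k such that i·x^h + j·y^h + k·z^h = 0 and i·x^{h+1} + j·y^{h+1} + k·z^{h+1} = 0. -/
open Polynomial in
/-- The `n`-th roots of unity multiply to `-1` when `n` is even. -/
theorem IsPrimitiveRoot.prod_nthRootsFinset_of_even {F : Type*} [Field F] {ζ : F} {n : ℕ}
    (hn : 0 < n) (hev : Even n) (hζ : IsPrimitiveRoot ζ n) :
    ∏ x ∈ nthRootsFinset n (1 : F), x = -1 := by
  have h := congrArg (eval 0) (X_pow_sub_one_eq_prod hn hζ)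
  simp only [eval_sub, eval_pow, eval_X, eval_one, zero_pow hn.ne', eval_prod, eval_C,
    zero_sub] at h
  rw [Finset.prod_neg, hζ.card_nthRootsFinset, hev.neg_one_pow, one_mul] at h
  exact h.symm

theorem FiniteField.exists_isPrimitiveRoot_of_dvd {F : Type*} [Field F] [Fintype F] {n : ℕ}
    (hn : n ∣ Fintype.card F - 1) : ∃ ζ : F, IsPrimitiveRoot ζ n := by
  obtain ⟨g, hg⟩ := IsCyclic.exists_ofOrder_eq_natCard (α := Fˣ)
  have hcard : Nat.card Fˣ = Fintype.card F - 1 := by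
    rw [Nat.card_units, Nat.card_eq_fintype_card]
  obtain ⟨d, hd⟩ := hn
  have hpos : 0 < Fintype.card F - 1 := Nat.sub_pos_of_lt Fintype.one_lt_card
  have hprim : IsPrimitiveRoot ((g : Fˣ) : F) (Fintype.card F - 1) := by
    rw [IsPrimitiveRoot.coe_units_iff, ← hcard, ← hg]
    exact IsPrimitiveRoot.orderOf g
  exact ⟨_, hprim.pow hpos (hd.trans (mul_comm _ _))⟩

theorem eq_one_of_pow_eq_one_of_coprime {M : Type*} [Monoid M] {x : M} {a b : ℕ}
    (hab : Nat.gcd a b = 1) (ha : x ^ a = 1) (hb : x ^ b = 1) : x = 1 := by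
  simpa [hab] using pow_gcd_eq_one.2 ⟨ha, hb⟩

/-- Two columns of the matrix with rows `x ^ h` and `x ^ (h + 1)` are linearly independent. -/
theorem eq_of_weight_two {F : Type*} [Field F] {h : ℕ} {x y i j : F} (hx : x ≠ 0) (hi : i ≠ 0)
    (h₀ : i * x ^ h + j * y ^ h = 0) (h₁ : i * x ^ (h + 1) + j * y ^ (h + 1) = 0) : x = y := by
  have : i * x ^ h * (x - y) = 0 := by linear_combination h₁ - y * h₀
  exact sub_eq_zero.1 ((mul_eq_zero.1 this).resolve_left (mul_ne_zero hi (pow_ne_zero h hx)))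

/-- If an automorphism inverts the support and fixes the coefficients of a codeword of weight
three, then any two support elements have the same `(2 * h + 1)`-th power. -/
theorem pow_eq_pow_of_weight_three {F : Type*} [Field F] (ψ : F →+* F) {h : ℕ} {x y z i j k : F}
    (hx : x ≠ 0) (hy : y ≠ 0) (hz : z ≠ 0) (hxz : x ≠ z) (hi : i ≠ 0)
    (hψx : ψ x = x⁻¹) (hψy : ψ y = y⁻¹) (hψz : ψ z = z⁻¹)
    (hψi : ψ i = i) (hψj : ψ j = j) (hψk : ψ k = k)
    (h₀ : i * x ^ h + j * y ^ h + k * z ^ h = 0)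
    (h₁ : i * x ^ (h + 1) + j * y ^ (h + 1) + k * z ^ (h + 1) = 0) :
    x ^ (2 * h + 1) = y ^ (2 * h + 1) := by
  have c₀ := congrArg ψ h₀
  have c₁ := congrArg ψ h₁
  simp only [map_add, map_mul, map_pow, map_zero, hψx, hψy, hψz, hψi, hψj, hψk, inv_pow]
    at c₀ c₁
  have e₀ : i * (x - z) * x ^ h = -(j * (y - z)) * y ^ h := by
    linear_combination h₁ - z * h₀
  have e₁ : i * (x - z) * y ^ (h + 1) = -(j * (y - z)) * x ^ (h + 1) := by
    have e : i * (x ^ h)⁻¹ + j * (y ^ h)⁻¹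
        = z * (i * (x ^ (h + 1))⁻¹ + j * (y ^ (h + 1))⁻¹) := by
      have : z * (z ^ (h + 1))⁻¹ = (z ^ h)⁻¹ := by
        field_simp
        ring
      linear_combination c₀ - z * c₁ + k * this
    rw [pow_succ, pow_succ] at e ⊢
    have hxh := pow_ne_zero h hx
    have hyh := pow_ne_zero h hy
    field_simp at e
    linear_combination e
  have hP : i * (x - z) ≠ 0 := mul_ne_zero hi (sub_ne_zero.2 hxz)
  apply mul_left_cancel₀ hP
  linear_combination x ^ (h + 1) * e₀ - y ^ h * e₁

/-- A root of unity whose trace to `F_q` is defined over `F_q`, which is inverted by the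
`q ^ m`-th power map, and whose order is odd and prime to `q + 1`, is trivial. -/
theorem eq_one_of_add_inv_fixed {F : Type*} [Field F] (φ : F →+* F) {q m h : ℕ}
    (hφ : ∀ x, φ x = x ^ q) (hgcd : Nat.gcd (2 * h + 1) (q + 1) = 1) {u : F} (hu : u ≠ 0)
    (hup : u ^ (2 * h + 1) = 1) (hum : u ^ (q ^ m + 1) = 1) (hfix : φ (u + u⁻¹) = u + u⁻¹) :
    u = 1 := by
  have hprod : (u ^ q - u) * (u ^ q - u⁻¹) = 0 := by
    have huq := pow_ne_zero q hu
    rw [map_add, map_inv₀, hφ] at hfix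
    have h₁ := mul_inv_cancel₀ hu
    have h₂ := mul_inv_cancel₀ huq
    linear_combination u ^ q * hfix + h₁ - h₂
  rcases mul_eq_zero.1 hprod with h₁ | h₁
  · have hq : u ^ q = u := sub_eq_zero.1 h₁
    have hqm : ∀ n : ℕ, u ^ q ^ n = u := by
      intro n
      induction n with
      | zero => simp
      | succ n ih => rw [pow_succ, pow_mul, ih, hq]
    rw [pow_succ, hqm, ← sq] at hum
    simpa [pow_succ, pow_mul, hum] using hup
  · apply eq_one_of_pow_eq_one_of_coprime hgcd hup
    rw [pow_succ, sub_eq_zero.1 h₁, inv_mul_cancel₀ hu]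

/-- There is no codeword of weight three. -/
theorem not_weight_three {F : Type*} [Field F] (φ ψ : F →+* F) {q m h : ℕ}
    (hφ : ∀ x, φ x = x ^ q) (hψ : ∀ x, ψ x = x ^ q ^ m)
    (hgcd : Nat.gcd (2 * h + 1) (q + 1) = 1) {x y z i j k : F}
    (hxy : x ≠ y) (hxz : x ≠ z)
    (hx : x ^ (q ^ m + 1) = 1) (hy : y ^ (q ^ m + 1) = 1) (hz : z ^ (q ^ m + 1) = 1)
    (hi : i ≠ 0) (hj : j ≠ 0) (hk : k ≠ 0)
    (hiq : i ^ q = i) (hjq : j ^ q = j) (hkq : k ^ q = k)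
    (h₀ : i * x ^ h + j * y ^ h + k * z ^ h = 0)
    (h₁ : i * x ^ (h + 1) + j * y ^ (h + 1) + k * z ^ (h + 1) = 0) : False := by
  have hne : ∀ {a : F}, a ^ (q ^ m + 1) = 1 → a ≠ 0 := by
    rintro a ha rfl
    simp at ha
  have hinv : ∀ {a : F}, a ^ (q ^ m + 1) = 1 → ψ a = a⁻¹ := by
    intro a ha
    rw [hψ]
    exact eq_inv_of_mul_eq_one_left (by rw [← pow_succ, ha])
  have hfix : ∀ {a : F}, a ^ q = a → ψ a = a := by
    intro a ha
    rw [hψ]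
    clear hx hy hz hψ hne hinv
    induction m with
    | zero => simp
    | succ n ih => rw [pow_succ, pow_mul, ih, ha]
  have hx0 := hne hx
  have hy0 := hne hy
  have hz0 := hne hz
  have exz : x ^ (2 * h + 1) = z ^ (2 * h + 1) :=
    pow_eq_pow_of_weight_three ψ hx0 hz0 hy0 hxy hi (hinv hx) (hinv hz) (hinv hy)
      (hfix hiq) (hfix hkq) (hfix hjq) (by linear_combination h₀) (by linear_combination h₁)
  have eyz : y ^ (2 * h + 1) = z ^ (2 * h + 1) :=
    pow_eq_pow_of_weight_three ψ hy0 hz0 hx0 hxy.symm hj (hinv hy) (hinv hz) (hinv hx)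
      (hfix hjq) (hfix hkq) (hfix hiq) (by linear_combination h₀) (by linear_combination h₁)
  have hpow : ∀ {a : F}, a ^ (2 * h + 1) = z ^ (2 * h + 1) →
      (a / z) ^ (h + 1) = ((a / z) ^ h)⁻¹ := by
    intro a ha
    apply eq_inv_of_mul_eq_one_left
    rw [← pow_add, show h + 1 + h = 2 * h + 1 by ring, div_pow, ha,
      div_self (pow_ne_zero _ hz0)]
  set u := (x / z) ^ h with hu
  set v := (y / z) ^ h with hv
  have hu0 : u ≠ 0 := pow_ne_zero _ (div_ne_zero hx0 hz0)
  have hv0 : v ≠ 0 := pow_ne_zero _ (div_ne_zero hy0 hz0)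
  have r₀ : i * u + j * v + k = 0 := by
    rw [hu, hv, div_pow, div_pow]
    have := pow_ne_zero h hz0
    field_simp
    linear_combination h₀
  have r₁ : i * u⁻¹ + j * v⁻¹ + k = 0 := by
    rw [← hpow exz, ← hpow eyz, div_pow, div_pow]
    have := pow_ne_zero (h + 1) hz0
    field_simp
    linear_combination h₁
  have htr : u + u⁻¹ = (j ^ 2 - k ^ 2 - i ^ 2) / (i * k) := by
    rw [eq_div_iff (mul_ne_zero hi hk)]
    linear_combination (k + i * u⁻¹) * r₀ - j * v * r₁ - i ^ 2 * mul_inv_cancel₀ hu0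
      + j ^ 2 * mul_inv_cancel₀ hv0
  have hu1 : u = 1 := by
    apply eq_one_of_add_inv_fixed φ (m := m) hφ hgcd hu0
    · rw [hu, pow_right_comm, div_pow, exz, div_self (pow_ne_zero _ hz0), one_pow]
    · rw [hu, pow_right_comm, div_pow, hx, hz, div_one, one_pow]
    · rw [htr]
      simp only [map_div₀, map_sub, map_pow, map_mul, hφ i, hφ j, hφ k, hiq, hjq, hkq]
  have hxz1 : x / z = 1 := by
    have := hpow exz
    rwa [pow_succ, ← hu, hu1, one_mul, inv_one] at this
  exact hxz ((div_eq_one_iff_eq hz0).1 hxz1)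

open Polynomial in
/-- The power map `x ↦ x ^ N` on the `(q + 1)`-th roots of unity agrees at two points other
than `1` and `-1` with a Möbius transformation fixing both `1` and `-1`. -/
theorem exists_pow_eq_mobius {F : Type*} [Field F] (φ : F →+* F) {q N : ℕ}
    (hφ : ∀ x, φ x = x ^ q) (hq : Odd q) (hq3 : 3 ≤ q) (h2 : (2 : F) ≠ 0)
    (hN : Odd N) (hgcd : Nat.gcd N (q + 1) = 1)
    {ζ ξ : F} (hζ : IsPrimitiveRoot ζ (q + 1)) (hξ : IsPrimitiveRoot ξ (q - 1)) :
    ∃ x y c : F, x ≠ y ∧ x ≠ 1 ∧ x ≠ -1 ∧ y ≠ 1 ∧ y ≠ -1 ∧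
      x ^ (q + 1) = 1 ∧ y ^ (q + 1) = 1 ∧
      (x ^ N - 1) * (x + 1) = c * ((x - 1) * (x ^ N + 1)) ∧
      (y ^ N - 1) * (y + 1) = c * ((y - 1) * (y ^ N + 1)) := by
  classical
  have hqe : Even (q + 1) := hq.add_one
  have hqe' : Even (q - 1) := Nat.Odd.sub_odd hq odd_one
  have h11 : (1 : F) ≠ -1 := fun h => h2 (by linear_combination h)
  set S : Finset F := ((nthRootsFinset (q + 1) (1 : F)).erase 1).erase (-1) with hS
  set T : Finset F := nthRootsFinset (q - 1) (1 : F) with hT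
  have memS : ∀ x, x ∈ S ↔ x ≠ -1 ∧ x ≠ 1 ∧ x ^ (q + 1) = 1 := by
    intro x
    rw [hS, Finset.mem_erase, Finset.mem_erase, mem_nthRootsFinset q.succ_pos]
  have cardS : S.card = q - 1 := by
    rw [hS, Finset.card_erase_of_mem, Finset.card_erase_of_mem, hζ.card_nthRootsFinset]
    · omega
    · simp [mem_nthRootsFinset]
    · rw [Finset.mem_erase, mem_nthRootsFinset q.succ_pos]
      exact ⟨h11.symm, hqe.neg_one_pow⟩
  have cardT : T.card = q - 1 := hξ.card_nthRootsFinset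
  have hpowinj : ∀ {x y : F}, y ≠ 0 → x ^ (q + 1) = 1 → y ^ (q + 1) = 1 →
      x ^ N = y ^ N → x = y := by
    intro x y hy0 hx hy hxy
    rw [← div_eq_one_iff_eq hy0]
    apply eq_one_of_pow_eq_one_of_coprime hgcd
    · rw [div_pow, hxy, div_self (pow_ne_zero _ hy0)]
    · rw [div_pow, hx, hy, div_one]
  have hne0 : ∀ {x : F}, x ^ (q + 1) = 1 → x ≠ 0 := by
    rintro x hx rfl
    simp at hx
  have hmaps : ∀ x ∈ S, x ^ N ∈ S := by
    intro x hx
    rw [memS] at hx ⊢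
    obtain ⟨hx1, hx2, hx3⟩ := hx
    refine ⟨fun h => hx1 ?_, fun h => hx2 ?_, by rw [pow_right_comm, hx3, one_pow]⟩
    · exact hpowinj (neg_ne_zero.2 one_ne_zero) hx3 hqe.neg_one_pow (by rw [h, hN.neg_one_pow])
    · exact hpowinj one_ne_zero hx3 (one_pow _) (by rw [h, one_pow])
  have hinj : Set.InjOn (fun x : F => x ^ N) S := by
    intro x hx y hy hxy
    have hx' := ((memS x).1 hx).2.2
    have hy' := ((memS y).1 hy).2.2
    exact hpowinj (hne0 hy') hx' hy' hxy
  have himage : S.image (fun x => x ^ N) = S :=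
    Finset.eq_of_subset_of_card_le (Finset.image_subset_iff.2 hmaps)
      (Finset.card_image_of_injOn hinj).ge
  let t : F → F := fun x => (x - 1) / (x + 1)
  have hadd : ∀ x ∈ S, x + 1 ≠ 0 := fun x hx h =>
    ((memS x).1 hx).1 (eq_neg_of_add_eq_zero_left h)
  have hsub : ∀ x ∈ S, x - 1 ≠ 0 := fun x hx => sub_ne_zero.2 ((memS x).1 hx).2.1
  have ht0 : ∀ x ∈ S, t x ≠ 0 := fun x hx => div_ne_zero (hsub x hx) (hadd x hx)
  have htφ : ∀ x ∈ S, φ (t x) = -t x := by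
    intro x hx
    have hx3 := ((memS x).1 hx).2.2
    have hx0 := hne0 hx3
    have hxq : φ x = x⁻¹ := by
      rw [hφ]
      exact eq_inv_of_mul_eq_one_left (by rw [← pow_succ, hx3])
    have ha := hadd x hx
    have ha' : 1 + x ≠ 0 := by rwa [add_comm]
    simp only [t, map_div₀, map_sub, map_add, map_one, hxq]
    field_simp
    ring
  let r : F → F := fun x => t (x ^ N) / t x
  have hrT : ∀ x ∈ S, r x ∈ T := by
    intro x hx
    rw [hT, mem_nthRootsFinset (by omega)]
    have hr0 : r x ≠ 0 := div_ne_zero (ht0 _ (hmaps x hx)) (ht0 x hx)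
    have hrφ : φ (r x) = r x := by
      simp only [r, map_div₀, htφ x hx, htφ _ (hmaps x hx), neg_div_neg_eq]
    rw [hφ] at hrφ
    apply mul_right_cancel₀ hr0
    rw [← pow_succ, Nat.sub_add_cancel (by omega), hrφ, one_mul]
  have hprod : ∏ x ∈ S, r x = 1 := by
    have hperm : ∏ x ∈ S, t (x ^ N) = ∏ x ∈ S, t x := by
      conv_rhs => rw [← himage, Finset.prod_image hinj]
    rw [Finset.prod_div_distrib, hperm, div_self (Finset.prod_ne_zero_iff.2 ht0)]
  have hninj : ¬ Set.InjOn r S := by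
    intro hr
    have hST : S.image r = T :=
      Finset.eq_of_subset_of_card_le (Finset.image_subset_iff.2 hrT)
        (by rw [Finset.card_image_of_injOn hr, cardS, cardT])
    have hT1 : ∏ x ∈ T, x = 1 := by rw [← hST, Finset.prod_image hr, hprod]
    rw [hξ.prod_nthRootsFinset_of_even (by omega) hqe'] at hT1
    exact h11 hT1.symm
  simp only [Set.InjOn, not_forall] at hninj
  obtain ⟨x, hx, y, hy, hxy, hne⟩ := hninj
  have key : ∀ a ∈ S, (a ^ N - 1) * (a + 1) = r a * ((a - 1) * (a ^ N + 1)) := by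
    intro a ha
    have h₁ := hadd a ha
    have h₂ := hsub a ha
    have h₃ := hadd _ (hmaps a ha)
    simp only [r, t]
    field_simp
  have hxS := (memS x).1 hx
  have hyS := (memS y).1 hy
  exact ⟨x, y, r x, hne, hxS.2.1, hxS.1, hyS.2.1, hyS.1, hxS.2.2, hyS.2.2,
    key x hx, hxy ▸ key y hy⟩

/-- A codeword supported on `x`, `y`, `1`, `-1` with coefficients in `F_q`, for `x` and `y` as in
`exists_pow_eq_mobius`. -/
theorem exists_codeword_of_mobius {F : Type*} [Field F] (φ : F →+* F) {h : ℕ} (h2 : (2 : F) ≠ 0)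
    {x y c : F} (hx0 : x ≠ 0) (hy0 : y ≠ 0) (hx1 : x ≠ 1) (hx1' : x ≠ -1) (hy1 : y ≠ 1)
    (hy1' : y ≠ -1) (hφx : φ x = x⁻¹) (hφy : φ y = y⁻¹)
    (hcx : (x ^ (2 * h + 1) - 1) * (x + 1) = c * ((x - 1) * (x ^ (2 * h + 1) + 1)))
    (hcy : (y ^ (2 * h + 1) - 1) * (y + 1) = c * ((y - 1) * (y ^ (2 * h + 1) + 1))) :
    ∃ j k l : F, j ≠ 0 ∧ φ j = j ∧ φ k = k ∧ φ l = l ∧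
      x ^ h + j * y ^ h + k + l * (-1) ^ h = 0 ∧
      x ^ (h + 1) + j * y ^ (h + 1) + k + l * (-1) ^ (h + 1) = 0 := by
  let b : F → ℕ → F := fun a n => a ^ n - a⁻¹ ^ n
  let β : F → F := fun a => b a h - b a (h + 1)
  have hrel : ∀ {a : F}, a ≠ 0 →
      (a ^ (2 * h + 1) - 1) * (a + 1) = c * ((a - 1) * (a ^ (2 * h + 1) + 1)) →
      (1 - c) * b a (h + 1) + (1 + c) * b a h = 0 := by
    intro a ha hc
    have hah := pow_ne_zero h ha
    simp only [b, inv_pow]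
    rw [pow_succ]
    rw [show a ^ (2 * h + 1) = a ^ h * a ^ h * a by ring] at hc
    field_simp
    linear_combination hc
  have hβ₀ : ∀ {a : F}, (1 - c) * b a (h + 1) + (1 + c) * b a h = 0 →
      2 * b a h = (1 - c) * β a := by
    intro a hc
    simp only [β]
    linear_combination hc
  have hβ₁ : ∀ {a : F}, (1 - c) * b a (h + 1) + (1 + c) * b a h = 0 →
      2 * b a (h + 1) = -(1 + c) * β a := by
    intro a hc
    simp only [β]
    linear_combination hc
  have hβ : ∀ {a : F}, a ≠ 0 → a ≠ 1 → a ≠ -1 →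
      (1 - c) * b a (h + 1) + (1 + c) * b a h = 0 → β a ≠ 0 := by
    intro a ha ha1 ha2 hc hz
    have e₀ := hβ₀ hc
    have e₁ := hβ₁ hc
    rw [hz, mul_zero] at e₀ e₁
    replace e₀ := (mul_eq_zero.1 e₀).resolve_left h2
    replace e₁ := (mul_eq_zero.1 e₁).resolve_left h2
    have hah := pow_ne_zero h ha
    simp only [b, inv_pow] at e₀ e₁
    rw [pow_succ] at e₁
    field_simp at e₀ e₁
    have hsq : a ^ 2 = 1 := by
      rw [← pow_mul] at e₀ e₁
      linear_combination e₁ - a ^ 2 * e₀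
    rcases sq_eq_one_iff.1 hsq with h' | h'
    · exact ha1 h'
    · exact ha2 h'
  have hφb : ∀ {a : F}, φ a = a⁻¹ → ∀ n, φ (b a n) = -b a n := by
    intro a ha n
    simp only [b, map_sub, map_pow, map_inv₀, ha, inv_inv]
    ring
  have hφβ : ∀ {a : F}, φ a = a⁻¹ → φ (β a) = -β a := by
    intro a ha
    simp only [β, map_sub, hφb ha]
    ring
  have hrx := hrel hx0 hcx
  have hry := hrel hy0 hcy
  have hβx := hβ hx0 hx1 hx1' hrx
  have hβy := hβ hy0 hy1 hy1' hry
  obtain ⟨j, hj⟩ : ∃ j : F, j = -(β x / β y) := ⟨_, rfl⟩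
  have hjβ : β x + j * β y = 0 := by
    rw [hj]
    field_simp
    ring
  have hφj : φ j = j := by
    rw [hj, map_neg, map_div₀, hφβ hφx, hφβ hφy, neg_div_neg_eq]
  have hb₀ : b x h + j * b y h = 0 := by
    apply mul_left_cancel₀ h2
    linear_combination hβ₀ hrx + j * hβ₀ hry + (1 - c) * hjβ
  have hb₁ : b x (h + 1) + j * b y (h + 1) = 0 := by
    apply mul_left_cancel₀ h2
    linear_combination hβ₁ hrx + j * hβ₁ hry - (1 + c) * hjβ
  have hφs : ∀ n, b x n + j * b y n = 0 → φ (x ^ n + j * y ^ n) = x ^ n + j * y ^ n := by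
    intro n hn
    simp only [b] at hn
    simp only [map_add, map_mul, map_pow, hφx, hφy, hφj]
    linear_combination -hn
  have hφs₀ := hφs h hb₀
  have hφs₁ := hφs (h + 1) hb₁
  set s₀ := x ^ h + j * y ^ h with hs₀
  set s₁ := x ^ (h + 1) + j * y ^ (h + 1) with hs₁
  have hsign : ((-1 : F) ^ h) * (-1) ^ h = 1 := by
    rw [← mul_pow]
    simp
  refine ⟨j, -(s₀ + s₁) / 2, (-1) ^ h * (s₁ - s₀) / 2, ?_, hφj, ?_, ?_, ?_, ?_⟩
  · rw [hj]
    exact neg_ne_zero.2 (div_ne_zero hβx hβy)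
  · simp only [map_div₀, map_neg, map_add, hφs₀, hφs₁, map_ofNat]
  · simp only [map_div₀, map_mul, map_pow, map_neg, map_one, map_sub, hφs₀, hφs₁, map_ofNat]
  · field_simp
    linear_combination (s₁ - s₀) * hsign
  · rw [pow_succ (-1 : F) h]
    field_simp
    linear_combination -(s₁ - s₀) * hsign


theorem stmt_7 (p : ℕ) (hp : Nat.Prime p) (hpodd : Odd p) (s m h : ℕ) (hs : 1 ≤ s)
    (hm : Odd m) (hm1 : 1 ≤ m) (q : ℕ) (hq : q = p ^ s)
    (hgcd : Nat.gcd (2 * h + 1) (q + 1) = 1)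
    (F : Type*) [Field F] [Fintype F] (hF : Fintype.card F = q ^ (2 * m)) :
    (∃ x y z w : F,
      x ≠ y ∧ x ≠ z ∧ x ≠ w ∧ y ≠ z ∧ y ≠ w ∧ z ≠ w ∧
      x ^ (q ^ m + 1) = 1 ∧ y ^ (q ^ m + 1) = 1 ∧
      z ^ (q ^ m + 1) = 1 ∧ w ^ (q ^ m + 1) = 1 ∧
      ∃ i j k l : F, i ≠ 0 ∧ j ≠ 0 ∧ k ≠ 0 ∧ l ≠ 0 ∧
        i ^ q = i ∧ j ^ q = j ∧ k ^ q = k ∧ l ^ q = l ∧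
        i * x ^ h + j * y ^ h + k * z ^ h + l * w ^ h = 0 ∧
        i * x ^ (h + 1) + j * y ^ (h + 1) + k * z ^ (h + 1) + l * w ^ (h + 1) = 0) ∧
    ¬(∃ x y z : F, x ≠ y ∧ x ≠ z ∧ y ≠ z ∧
      x ^ (q ^ m + 1) = 1 ∧ y ^ (q ^ m + 1) = 1 ∧ z ^ (q ^ m + 1) = 1 ∧
      ∃ i j k : F, i ≠ 0 ∧ j ≠ 0 ∧ k ≠ 0 ∧
        i ^ q = i ∧ j ^ q = j ∧ k ^ q = k ∧
        i * x ^ h + j * y ^ h + k * z ^ h = 0 ∧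
        i * x ^ (h + 1) + j * y ^ (h + 1) + k * z ^ (h + 1) = 0) := by
  have : Fact p.Prime := ⟨hp⟩
  have hp2 : p ≠ 2 := by
    rintro rfl
    exact absurd hpodd (by decide)
  have hcharP : CharP F p :=
    charP_of_card_eq_prime_pow (f := s * (2 * m)) (by rw [hF, hq, ← pow_mul])
  have h2 : (2 : F) ≠ 0 := Ring.two_ne_zero (by rwa [ringChar.eq F p])
  have hqodd : Odd q := hq ▸ hpodd.pow
  have hq3 : 3 ≤ q := by
    have h3 : 3 ≤ p := by
      have := hp.two_le
      omega
    exact hq ▸ h3.trans (Nat.le_self_pow (by omega) p)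
  let φ : F →+* F := iterateFrobenius F p s
  let ψ : F →+* F := iterateFrobenius F p (s * m)
  have hφ : ∀ x, φ x = x ^ q := fun x => by rw [hq]; exact iterateFrobenius_def p s x
  have hψ : ∀ x, ψ x = x ^ q ^ m := fun x => by
    rw [hq, ← pow_mul]
    exact iterateFrobenius_def p (s * m) x
  refine ⟨?_, ?_⟩
  · have hdvd : q ^ 2 - 1 ∣ Fintype.card F - 1 := by
      rw [hF, pow_mul]
      simpa using Nat.sub_dvd_pow_sub_pow (q ^ 2) 1 m
    have hfac : q ^ 2 - 1 = (q + 1) * (q - 1) := by simpa using Nat.sq_sub_sq q 1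
    obtain ⟨ζ, hζ⟩ := FiniteField.exists_isPrimitiveRoot_of_dvd (F := F) (n := q + 1)
      ((Dvd.intro _ hfac.symm).trans hdvd)
    obtain ⟨ξ, hξ⟩ := FiniteField.exists_isPrimitiveRoot_of_dvd (F := F) (n := q - 1)
      ((Dvd.intro_left _ hfac.symm).trans hdvd)
    obtain ⟨x, y, c, hxy, hx1, hx1', hy1, hy1', hx, hy, hcx, hcy⟩ :=
      exists_pow_eq_mobius φ hφ hqodd hq3 h2 (odd_two_mul_add_one h) hgcd hζ hξ
    have hne0 : ∀ {a : F}, a ^ (q + 1) = 1 → a ≠ 0 := by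
      rintro a ha rfl
      simp at ha
    have hinv : ∀ {a : F}, a ^ (q + 1) = 1 → φ a = a⁻¹ := by
      intro a ha
      rw [hφ]
      exact eq_inv_of_mul_eq_one_left (by rw [← pow_succ, ha])
    have hdvd' : q + 1 ∣ q ^ m + 1 := by
      simpa using hm.nat_add_dvd_pow_add_pow q 1
    have hU : ∀ {a : F}, a ^ (q + 1) = 1 → a ^ (q ^ m + 1) = 1 := by
      intro a ha
      obtain ⟨d, hd⟩ := hdvd'
      rw [hd, pow_mul, ha, one_pow]
    have h11 : (1 : F) ≠ -1 := fun h' => h2 (by linear_combination h')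
    have hneg : (-1 : F) ^ (q + 1) = 1 := hqodd.add_one.neg_one_pow
    obtain ⟨j, k, l, hj, hφj, hφk, hφl, r₀, r₁⟩ :=
      exists_codeword_of_mobius φ h2 (hne0 hx) (hne0 hy) hx1 hx1' hy1 hy1' (hinv hx) (hinv hy)
        hcx hcy
    rw [hφ] at hφj hφk hφl
    have hk : k ≠ 0 := by
      rintro rfl
      by_cases hl : l = 0
      · subst hl
        exact hxy (eq_of_weight_two (h := h) (j := j) (hne0 hx) one_ne_zero
          (by linear_combination r₀) (by linear_combination r₁))
      · exact not_weight_three φ ψ hφ hψ hgcd hxy hx1' (hU hx) (hU hy) (hU hneg)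
          one_ne_zero hj hl (one_pow q) hφj hφl
          (by linear_combination r₀) (by linear_combination r₁)
    have hl : l ≠ 0 := by
      rintro rfl
      exact not_weight_three φ ψ hφ hψ hgcd hxy hx1 (hU hx) (hU hy) (one_pow _)
        one_ne_zero hj hk (one_pow q) hφj hφk
        (by rw [one_pow]; linear_combination r₀) (by rw [one_pow]; linear_combination r₁)
    exact ⟨x, y, 1, -1, hxy, hx1, hx1', hy1, hy1', h11, hU hx, hU hy, one_pow _, hU hneg,
      1, j, k, l, one_ne_zero, hj, hk, hl, one_pow q, hφj, hφk, hφl,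
      by rw [one_pow]; linear_combination r₀, by rw [one_pow]; linear_combination r₁⟩
  · rintro ⟨x, y, z, hxy, hxz, -, hx, hy, hz, i, j, k, hi, hj, hk, hiq, hjq, hkq, h₀, h₁⟩
    exact not_weight_three φ ψ hφ hψ hgcd hxy hxz hx hy hz hi hj hk hiq hjq hkq h₀ h₁
end

section
/- Let p be an odd prime, q = p^s with s ≥ 1, let m ≥ 2 be even, let h ≥ 0 be an integer with gcd(h, q^m+1) ≥ 3 or gcd(h+1, q^m+1) ≥ 3, and let F be a finite field with q^{2m} elements. Then there exist pairwise distinct x, y, z, w ∈ F with x^{q^m+1} = y^{q^m+1} = z^{q^m+1} = w^{q^m+1} = 1 and nonzero i, j, k, l ∈ F satisfying i^q = i, j^q = j, k^q = k, l^q = l such that i·x^h + j·y^h + k·z^h + l·w^h = 0 and i·x^{h+1} + j·y^{h+1} + k·z^{h+1} + l·w^{h+1} = 0. -/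
theorem FiniteField.exists_pow_eq_one_and_sq_ne_one {F : Type*} [Field F] [Fintype F] {d : ℕ}
    (hd : 3 ≤ d) (hdvd : d ∣ Fintype.card F - 1) : ∃ t : F, t ^ d = 1 ∧ t ^ 2 ≠ 1 := by
  obtain ⟨g, hg⟩ := IsCyclic.exists_ofOrder_eq_natCard (α := Fˣ)
  rw [Nat.card_units, Nat.card_eq_fintype_card] at hg
  have hne : orderOf g ≠ 0 := (orderOf_pos g).ne'
  have hord : orderOf (g ^ (orderOf g / d)) = d :=
    orderOf_pow_orderOf_div hne (hg ▸ hdvd)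
  refine ⟨((g ^ (orderOf g / d) : Fˣ) : F), ?_, fun hsq => ?_⟩
  · rw [← Units.val_pow_eq_pow_val, ← hord, hord, orderOf_dvd_iff_pow_eq_one.mp hord.dvd,
      Units.val_one]
  · have h2 : (g ^ (orderOf g / d)) ^ 2 = 1 := by
      ext
      simpa using hsq
    have := Nat.le_of_dvd two_pos (hord ▸ orderOf_dvd_of_pow_eq_one h2)
    omega


theorem stmt_8 (p : ℕ) (hp : Nat.Prime p) (hpodd : Odd p) (s m h : ℕ) (hs : 1 ≤ s)
    (hm : Even m) (hm2 : 2 ≤ m) (q : ℕ) (hq : q = p ^ s)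
    (hgcd : 3 ≤ Nat.gcd h (q ^ m + 1) ∨ 3 ≤ Nat.gcd (h + 1) (q ^ m + 1))
    (F : Type*) [Field F] [Fintype F] (hF : Fintype.card F = q ^ (2 * m)) :
    ∃ x y z w : F,
      x ≠ y ∧ x ≠ z ∧ x ≠ w ∧ y ≠ z ∧ y ≠ w ∧ z ≠ w ∧
      x ^ (q ^ m + 1) = 1 ∧ y ^ (q ^ m + 1) = 1 ∧
      z ^ (q ^ m + 1) = 1 ∧ w ^ (q ^ m + 1) = 1 ∧
      ∃ i j k l : F, i ≠ 0 ∧ j ≠ 0 ∧ k ≠ 0 ∧ l ≠ 0 ∧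
        i ^ q = i ∧ j ^ q = j ∧ k ^ q = k ∧ l ^ q = l ∧
        i * x ^ h + j * y ^ h + k * z ^ h + l * w ^ h = 0 ∧
        i * x ^ (h + 1) + j * y ^ (h + 1) + k * z ^ (h + 1) + l * w ^ (h + 1) = 0 := by
  have hqodd : Odd q := hq ▸ hpodd.pow
  have hNeven : Even (q ^ m + 1) := hqodd.pow.add_one
  have hneg : (-1 : F) ≠ 1 := by
    refine Ring.neg_one_ne_one_of_char_ne_two fun hchar => ?_
    have hcard : Odd (Fintype.card F) := hF ▸ hqodd.pow
    exact Nat.not_even_iff_odd.mpr hcard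
      (Nat.even_iff.mpr (FiniteField.even_card_of_char_two hchar))
  have hdvd : q ^ m + 1 ∣ Fintype.card F - 1 := by
    refine ⟨q ^ m - 1, ?_⟩
    rw [hF, mul_comm 2 m, pow_mul]
    simpa using Nat.sq_sub_sq (q ^ m) 1
  obtain ⟨t, htN, ht2, hth⟩ :
      ∃ t : F, t ^ (q ^ m + 1) = 1 ∧ t ^ 2 ≠ 1 ∧ (t ^ h = 1 ∨ t ^ (h + 1) = 1) := by
    rcases hgcd with hd | hd
    all_goals
      obtain ⟨t, ht, ht2⟩ := FiniteField.exists_pow_eq_one_and_sq_ne_one (F := F) hd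
        ((Nat.gcd_dvd_right _ _).trans hdvd)
      have ht_pow := orderOf_dvd_of_pow_eq_one ht
      refine ⟨t, orderOf_dvd_iff_pow_eq_one.mp (ht_pow.trans (Nat.gcd_dvd_right _ _)), ht2, ?_⟩
      have := orderOf_dvd_iff_pow_eq_one.mp (ht_pow.trans (Nat.gcd_dvd_left _ _))
      tauto
  have ht1 : t ≠ 1 := by
    rintro rfl
    simp at ht2
  have htneg : t ≠ -1 := by
    rintro rfl
    simp at ht2
  have ht0 : t ≠ 0 := by
    rintro rfl
    simp at htN
  have htt : t ≠ -t := fun H => hneg <| mul_right_cancel₀ ht0 (by linear_combination -H)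
  obtain ⟨c, hc, hsign⟩ : ∃ c : F, (c = 1 ∨ c = -1) ∧
      (t ^ h = 1 ∧ c = (-1) ^ h ∨ t ^ (h + 1) = 1 ∧ c = (-1) ^ (h + 1)) := by
    rcases hth with H | H
    · exact ⟨_, neg_one_pow_eq_or F h, .inl ⟨H, rfl⟩⟩
    · exact ⟨_, neg_one_pow_eq_or F (h + 1), .inr ⟨H, rfl⟩⟩
  have hc0 : c ≠ 0 := by rcases hc with rfl | rfl <;> simp
  have hcq : c ^ q = c := by rcases hc with rfl | rfl <;> simp [hqodd.neg_one_pow]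
  refine ⟨t, -t, 1, -1, htt, ht1, htneg, fun H => htneg (by linear_combination -H),
    fun H => ht1 (neg_injective H), hneg.symm, htN, by rw [hNeven.neg_pow, htN], one_pow _,
    hNeven.neg_one_pow, 1, c, -1, -c, one_ne_zero, hc0, by simp, neg_ne_zero.mpr hc0,
    one_pow _, hcq, hqodd.neg_one_pow, by rw [hqodd.neg_pow, hcq], ?_⟩
  rw [neg_pow t h, neg_pow t (h + 1), pow_succ (-1 : F) h]
  rw [pow_succ (-1 : F) h] at hsign
  rcases neg_one_pow_eq_or F h with he | he <;> rw [he] at hsign ⊢ <;>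
    rcases hsign with ⟨H, rfl⟩ | ⟨H, rfl⟩ <;> rw [H] <;> constructor <;> ring
end

section
/- Let m ≥ 2 be even, let h ≥ 0 be an integer with gcd(h, 3^m+1) ≤ 2 and gcd(h+1, 3^m+1) ≤ 2, and let F be a finite field with 3^{2m} elements. Then there do not exist pairwise distinct x, y, z, w ∈ F with x^{3^m+1} = y^{3^m+1} = z^{3^m+1} = w^{3^m+1} = 1 and signs i, j, k, l ∈ {1, −1} ⊆ F such that i·x^h + j·y^h + k·z^h + l·w^h = 0 and i·x^{h+1} + j·y^{h+1} + k·z^{h+1} + l·w^{h+1} = 0. -/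
/-- If `n` is twice an odd number and `gcd h n ≤ 2`, then `n`-th roots of unity whose `h`-th powers
agree up to sign agree up to sign themselves. -/
theorem sq_eq_sq_of_pow_sq_eq_pow_sq {F : Type*} [Field F] {N h : ℕ} (hN : Odd N)
    (hgcd : Nat.gcd h (2 * N) ≤ 2) {x y : F} (hx : x ^ (2 * N) = 1) (hy : y ^ (2 * N) = 1)
    (hxy : (x ^ h) ^ 2 = (y ^ h) ^ 2) : x ^ 2 = y ^ 2 := by
  have hN0 : 2 * N ≠ 0 := by have := hN.pos; omega
  have hy0 : y ≠ 0 := by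
    rintro rfl
    simp [zero_pow hN0] at hy
  have hpow : (x / y) ^ (2 * h) = 1 := by
    rw [div_pow, mul_comm, pow_mul, pow_mul, hxy, div_self (by positivity)]
  have hroot : (x / y) ^ (2 * N) = 1 := by rw [div_pow, hx, hy, div_one]
  have hcop : Nat.gcd h N = 1 := by
    have hodd : Odd (Nat.gcd h N) := hN.of_dvd_nat (Nat.gcd_dvd_right h N)
    have hle : Nat.gcd h N ≤ Nat.gcd h (2 * N) :=
      Nat.le_of_dvd (Nat.gcd_pos_of_pos_right _ (Nat.pos_of_ne_zero hN0))
        (Nat.gcd_dvd_gcd_mul_left_right _ _ _)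
    obtain ⟨k, hk⟩ := hodd
    omega
  have hsq : (x / y) ^ 2 = 1 := by
    have := Nat.dvd_gcd (orderOf_dvd_of_pow_eq_one hpow) (orderOf_dvd_of_pow_eq_one hroot)
    rw [Nat.gcd_mul_left, hcop] at this
    exact orderOf_dvd_iff_pow_eq_one.1 this
  rwa [div_pow, div_eq_one_iff_eq (pow_ne_zero 2 hy0)] at hsq

/-- Four elements of norm one with vanishing sum cancel in pairs. -/
theorem add_eq_zero_of_add_add_add_eq_zero {F : Type*} [Field F] {p : ℕ} [Fact p.Prime]
    [CharP F p] {m : ℕ} {a b c d : F} (ha : a ^ (p ^ m + 1) = 1) (hb : b ^ (p ^ m + 1) = 1)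
    (hc : c ^ (p ^ m + 1) = 1) (hd : d ^ (p ^ m + 1) = 1) (h : a + b + c + d = 0) :
    a + b = 0 ∨ a + c = 0 ∨ a + d = 0 := by
  have hconj : a ^ p ^ m + b ^ p ^ m + c ^ p ^ m + d ^ p ^ m = 0 := by
    simp only [← add_pow_char_pow, h]
    exact zero_pow (pow_ne_zero _ (Fact.out : p.Prime).ne_zero)
  rw [pow_succ] at ha hb hc hd
  have hprod : (a + b) * ((a + c) * (a + d)) = 0 := by
    linear_combination a ^ 2 * h + a * b * c * d * hconj - b * c * d * ha - a * c * d * hb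
      - a * b * d * hc - a * b * c * hd
  simpa only [mul_eq_zero] using hprod

theorem eq_of_sq_eq_sq_of_ne {F : Type*} [Field F] {x y z : F} (hy : x ^ 2 = y ^ 2)
    (hz : x ^ 2 = z ^ 2) (hxy : x ≠ y) (hxz : x ≠ z) : y = z := by
  have h₁ := (sq_eq_sq_iff_eq_or_eq_neg.1 hy).resolve_left hxy
  have h₂ := (sq_eq_sq_iff_eq_or_eq_neg.1 hz).resolve_left hxz
  exact neg_injective (h₁.symm.trans h₂)

theorem pow_sq_eq_pow_sq_of_signed_add_eq_zero {F : Type*} [Field F] {i j x y : F} {n : ℕ}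
    (hi : i = 1 ∨ i = -1) (hj : j = 1 ∨ j = -1) (h : i * x ^ n + j * y ^ n = 0) :
    (x ^ n) ^ 2 = (y ^ n) ^ 2 := by
  have hi2 : i ^ 2 = 1 := sq_eq_one_iff.2 hi
  have hj2 : j ^ 2 = 1 := sq_eq_one_iff.2 hj
  linear_combination (i * x ^ n - j * y ^ n) * h - (x ^ n) ^ 2 * hi2 + (y ^ n) ^ 2 * hj2

theorem eq_of_signed_add_eq_zero {F : Type*} [Field F] {i j x y : F} {n : ℕ}
    (hi : i = 1 ∨ i = -1) (hx : x ≠ 0) (h : i * x ^ n + j * y ^ n = 0)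
    (h' : i * x ^ (n + 1) + j * y ^ (n + 1) = 0) : x = y := by
  have hi0 : i ≠ 0 := by rcases hi with rfl | rfl <;> simp
  have hprod : i * x ^ n * (x - y) = 0 := by linear_combination h' - y * h
  exact sub_eq_zero.1 ((mul_eq_zero.1 hprod).resolve_left (mul_ne_zero hi0 (pow_ne_zero n hx)))

theorem odd_half_three_pow_add_one {m : ℕ} (hm : Even m) : ∃ N, Odd N ∧ 3 ^ m + 1 = 2 * N := by
  obtain ⟨r, rfl⟩ := hm
  have hmod : 3 ^ (r + r) % 4 = 1 := by
    rw [← two_mul, pow_mul, Nat.pow_mod]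
    norm_num
  exact ⟨(3 ^ (r + r) + 1) / 2, by rw [Nat.odd_iff]; omega, by omega⟩

theorem stmt_9 (m h : ℕ) (hm : Even m) (hm2 : 2 ≤ m)
    (hgh : Nat.gcd h (3 ^ m + 1) ≤ 2) (hgh1 : Nat.gcd (h + 1) (3 ^ m + 1) ≤ 2)
    (F : Type*) [Field F] [Fintype F] (hF : Fintype.card F = 3 ^ (2 * m)) :
    ¬ ∃ x y z w : F,
      x ≠ y ∧ x ≠ z ∧ x ≠ w ∧ y ≠ z ∧ y ≠ w ∧ z ≠ w ∧
      x ^ (3 ^ m + 1) = 1 ∧ y ^ (3 ^ m + 1) = 1 ∧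
      z ^ (3 ^ m + 1) = 1 ∧ w ^ (3 ^ m + 1) = 1 ∧
      ∃ i j k l : F,
        (i = 1 ∨ i = -1) ∧ (j = 1 ∨ j = -1) ∧ (k = 1 ∨ k = -1) ∧ (l = 1 ∨ l = -1) ∧
        i * x ^ h + j * y ^ h + k * z ^ h + l * w ^ h = 0 ∧
        i * x ^ (h + 1) + j * y ^ (h + 1) + k * z ^ (h + 1) + l * w ^ (h + 1) = 0 := by
  rintro ⟨x, y, z, w, hxy, hxz, hxw, hyz, hyw, hzw, hx, hy, hz, hw, i, j, k, l,
    hi, hj, hk, hl, hs, hs'⟩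
  have : Fact (Nat.Prime 3) := ⟨Nat.prime_three⟩
  have : CharP F 3 := charP_of_card_eq_prime_pow hF
  obtain ⟨N, hN, hNm⟩ := odd_half_three_pow_add_one hm
  have hx0 : x ≠ 0 := by
    rintro rfl
    simp at hx
  have hunit : ∀ {e u : F} (n : ℕ), (e = 1 ∨ e = -1) → u ^ (3 ^ m + 1) = 1 →
      (e * u ^ n) ^ (3 ^ m + 1) = 1 := by
    intro e u n he hu
    rw [mul_pow, pow_right_comm, hu, one_pow, mul_one]
    rcases he with rfl | rfl
    · exact one_pow _
    · exact Even.neg_one_pow ⟨N, by omega⟩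
  have hsq : ∀ {e v : F} {n : ℕ}, Nat.gcd n (3 ^ m + 1) ≤ 2 → (e = 1 ∨ e = -1) →
      v ^ (3 ^ m + 1) = 1 → i * x ^ n + e * v ^ n = 0 → x ^ 2 = v ^ 2 := by
    intro e v n hn he hv hsum
    rw [hNm] at hn hv hx
    exact sq_eq_sq_of_pow_sq_eq_pow_sq hN hn hx hv
      (pow_sq_eq_pow_sq_of_signed_add_eq_zero hi he hsum)
  have hpair := add_eq_zero_of_add_add_add_eq_zero (hunit h hi hx) (hunit h hj hy)
    (hunit h hk hz) (hunit h hl hw) hs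
  have hpair' := add_eq_zero_of_add_add_add_eq_zero (hunit (h + 1) hi hx) (hunit (h + 1) hj hy)
    (hunit (h + 1) hk hz) (hunit (h + 1) hl hw) hs'
  rcases hpair with h₁ | h₁ | h₁ <;> rcases hpair' with h₂ | h₂ | h₂
  · exact hxy (eq_of_signed_add_eq_zero hi hx0 h₁ h₂)
  · exact hyz (eq_of_sq_eq_sq_of_ne (hsq hgh hj hy h₁) (hsq hgh1 hk hz h₂) hxy hxz)
  · exact hyw (eq_of_sq_eq_sq_of_ne (hsq hgh hj hy h₁) (hsq hgh1 hl hw h₂) hxy hxw)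
  · exact hyz (eq_of_sq_eq_sq_of_ne (hsq hgh1 hj hy h₂) (hsq hgh hk hz h₁) hxy hxz)
  · exact hxz (eq_of_signed_add_eq_zero hi hx0 h₁ h₂)
  · exact hzw (eq_of_sq_eq_sq_of_ne (hsq hgh hk hz h₁) (hsq hgh1 hl hw h₂) hxz hxw)
  · exact hyw (eq_of_sq_eq_sq_of_ne (hsq hgh1 hj hy h₂) (hsq hgh hl hw h₁) hxy hxw)
  · exact hzw (eq_of_sq_eq_sq_of_ne (hsq hgh1 hk hz h₂) (hsq hgh hl hw h₁) hxz hxw)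
  · exact hxw (eq_of_signed_add_eq_zero hi hx0 h₁ h₂)
end

section
/- Let m ≥ 2 satisfy m ≡ 2 (mod 4), let h ≥ 0 be an integer with gcd(h, 3^m+1) ≤ 2 and gcd(h+1, 3^m+1) ≤ 2, and let F be a finite field with 3^{2m} elements. Then there exist five pairwise distinct elements u_1, u_2, u_3, u_4, u_5 ∈ F with u_t^{3^m+1} = 1 for all t, such that u_1^h + u_2^h + u_3^h + u_4^h + u_5^h = 0 and u_1^{h+1} + u_2^{h+1} + u_3^{h+1} + u_4^{h+1} + u_5^{h+1} = 0. -/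
/-- The powers of `ζ ^ k` run through all fifth roots of unity when `5 ∤ k`, so they sum to zero. -/
theorem IsPrimitiveRoot.sum_pow_five_eq_zero {R : Type*} [CommRing R] [IsDomain R] {ζ : R}
    (hζ : IsPrimitiveRoot ζ 5) {k : ℕ} (hk : ¬ 5 ∣ k) :
    (ζ ^ 0) ^ k + (ζ ^ 1) ^ k + (ζ ^ 2) ^ k + (ζ ^ 3) ^ k + (ζ ^ 4) ^ k = 0 := by
  have hcop : k.Coprime 5 := ((Nat.Prime.coprime_iff_not_dvd Nat.prime_five).2 hk).symm
  have hsum := (hζ.pow_of_coprime k hcop).geom_sum_eq_zero (by norm_num)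
  simpa [Finset.sum_range_succ, ← pow_mul, mul_comm] using hsum

theorem not_five_dvd_of_gcd_le_two {a n : ℕ} (hn : 0 < n) (hdvd : 5 ∣ n)
    (h : Nat.gcd a n ≤ 2) : ¬ 5 ∣ a := fun ha => by
  have := Nat.le_of_dvd (Nat.gcd_pos_of_pos_right a hn) (Nat.dvd_gcd ha hdvd)
  omega

theorem five_dvd_three_pow_add_one {m : ℕ} (hm : m % 4 = 2) : 5 ∣ 3 ^ m + 1 := by
  obtain ⟨k, rfl⟩ : ∃ k, m = 4 * k + 2 := ⟨m / 4, by omega⟩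
  rw [Nat.dvd_iff_mod_eq_zero, pow_add, pow_mul, Nat.add_mod, Nat.mul_mod, Nat.pow_mod]
  norm_num

theorem stmt_10 (m h : ℕ) (hm2 : 2 ≤ m) (hm : m % 4 = 2)
    (hgh : Nat.gcd h (3 ^ m + 1) ≤ 2) (hgh1 : Nat.gcd (h + 1) (3 ^ m + 1) ≤ 2)
    (F : Type*) [Field F] [Fintype F] (hF : Fintype.card F = 3 ^ (2 * m)) :
    ∃ u₁ u₂ u₃ u₄ u₅ : F,
      u₁ ≠ u₂ ∧ u₁ ≠ u₃ ∧ u₁ ≠ u₄ ∧ u₁ ≠ u₅ ∧ u₂ ≠ u₃ ∧ u₂ ≠ u₄ ∧ u₂ ≠ u₅ ∧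
      u₃ ≠ u₄ ∧ u₃ ≠ u₅ ∧ u₄ ≠ u₅ ∧
      u₁ ^ (3 ^ m + 1) = 1 ∧ u₂ ^ (3 ^ m + 1) = 1 ∧ u₃ ^ (3 ^ m + 1) = 1 ∧
      u₄ ^ (3 ^ m + 1) = 1 ∧ u₅ ^ (3 ^ m + 1) = 1 ∧
      u₁ ^ h + u₂ ^ h + u₃ ^ h + u₄ ^ h + u₅ ^ h = 0 ∧
      u₁ ^ (h + 1) + u₂ ^ (h + 1) + u₃ ^ (h + 1) + u₄ ^ (h + 1) + u₅ ^ (h + 1) = 0 := by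
  have h5 : 5 ∣ 3 ^ m + 1 := five_dvd_three_pow_add_one hm
  have hcard : 5 ∣ Nat.card Fˣ := by
    rw [Nat.card_units, Nat.card_eq_fintype_card, hF, mul_comm, pow_mul]
    exact h5.trans ⟨3 ^ m - 1, by simpa using Nat.sq_sub_sq (3 ^ m) 1⟩
  have : Fact (Nat.Prime 5) := ⟨Nat.prime_five⟩
  obtain ⟨z, hz⟩ := exists_prime_orderOf_dvd_card' 5 hcard
  have hζ : IsPrimitiveRoot (z : F) 5 :=
    IsPrimitiveRoot.coe_units_iff.2 (hz ▸ IsPrimitiveRoot.orderOf z)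
  have hne (i j : ℕ) (hi : i < 5) (hj : j < 5) (hij : i ≠ j) : (z : F) ^ i ≠ (z : F) ^ j :=
    fun h => hij (hζ.pow_inj hi hj h)
  have hone (i : ℕ) : ((z : F) ^ i) ^ (3 ^ m + 1) = 1 := by
    rw [← pow_mul, hζ.pow_eq_one_iff_dvd]
    exact h5.mul_left i
  refine ⟨(z : F) ^ 0, (z : F) ^ 1, (z : F) ^ 2, (z : F) ^ 3, (z : F) ^ 4,
    ?_, ?_, ?_, ?_, ?_, ?_, ?_, ?_, ?_, ?_, hone 0, hone 1, hone 2, hone 3, hone 4,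
    hζ.sum_pow_five_eq_zero (not_five_dvd_of_gcd_le_two (Nat.succ_pos _) h5 hgh),
    hζ.sum_pow_five_eq_zero (not_five_dvd_of_gcd_le_two (Nat.succ_pos _) h5 hgh1)⟩ <;>
  exact hne _ _ (by norm_num) (by norm_num) (by norm_num)
end

section
/- Let m ≥ 4 satisfy m ≡ 0 (mod 4), let h ≥ 0 be an integer with gcd(h, 3^m+1) ≤ 2 and gcd(h+1, 3^m+1) ≤ 2, and suppose there exists an integer i with 0 ≤ i ≤ 2m−1 such that (h+1)·3^i ≡ 2h (mod 3^m+1). Let F be a finite field with 3^{2m} elements. Then there do not exist pairwise distinct u_1, u_2, u_3, u_4, u_5 ∈ F with u_t^{3^m+1} = 1 for all t and signs j_1, j_2, j_3, j_4, j_5 ∈ {1, −1} ⊆ F such that j_1·u_1^h + j_2·u_2^h + j_3·u_3^h + j_4·u_4^h + j_5·u_5^h = 0 and j_1·u_1^{h+1} + j_2·u_2^{h+1} + j_3·u_3^{h+1} + j_4·u_4^{h+1} + j_5·u_5^{h+1} = 0. -/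
theorem eq_of_pow_eq_of_coprime {F : Type*} [Field F] {a b : F} {n k : ℕ} (hnk : n.Coprime k)
    (hb : b ≠ 0) (ha' : a ^ k = 1) (hb' : b ^ k = 1) (h : a ^ n = b ^ n) : a = b := by
  have h1 : (a / b) ^ n = 1 := by rw [div_pow, h, div_self (pow_ne_zero _ hb)]
  have h2 : (a / b) ^ k = 1 := by rw [div_pow, ha', hb', div_one]
  exact (div_eq_one_iff_eq hb).mp ((pow_eq_one_iff_of_coprime hnk).mp ⟨h1, h2⟩)

/-- In characteristic three, if a triple and a pair of nonzero elements have the same power sums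
of exponents `1`, `2`, `-1` and `-2`, then the two elements of the pair coincide. -/
theorem eq_of_triple_pair_power_sums {F : Type*} [Field F] [CharP F 3] {a b c d e : F}
    (ha : a ≠ 0) (hb : b ≠ 0) (hc : c ≠ 0) (hd : d ≠ 0) (he : e ≠ 0)
    (h1 : a + b + c = d + e) (h2 : a ^ 2 + b ^ 2 + c ^ 2 = d ^ 2 + e ^ 2)
    (h1' : a⁻¹ + b⁻¹ + c⁻¹ = d⁻¹ + e⁻¹)
    (h2' : a⁻¹ ^ 2 + b⁻¹ ^ 2 + c⁻¹ ^ 2 = d⁻¹ ^ 2 + e⁻¹ ^ 2) : d = e := by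
  have h3 : (3 : F) = 0 := by exact_mod_cast CharP.cast_eq_zero F 3
  have esymm_two {a b c d e : F} (h1 : a + b + c = d + e)
      (h2 : a ^ 2 + b ^ 2 + c ^ 2 = d ^ 2 + e ^ 2) : a * b + a * c + b * c = d * e := by
    linear_combination 2 * (a + b + c + d + e) * h1 - 2 * h2 -
      (a * b + a * c + b * c - d * e) * h3
  have hde : a * b + a * c + b * c = d * e := esymm_two h1 h2
  have hinv := esymm_two h1' h2'
  have e1 : (a * b + a * c + b * c) * (d * e) = (d + e) * (a * b * c) := by
    field_simp at h1'
    linear_combination h1'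
  have e2 : (a + b + c) * (d * e) = a * b * c := by
    field_simp at hinv
    linear_combination hinv
  have hprod : d * e = (d + e) ^ 2 := by
    apply mul_right_cancel₀ (mul_ne_zero hd he)
    linear_combination e1 - (d * e) * hde - (d + e) * e2 + (d + e) * (d * e) * h1
  have hsq : (d - e) ^ 2 = 0 := by
    linear_combination -hprod - (d * e) * h3
  exact sub_eq_zero.mp (pow_eq_zero_iff two_ne_zero |>.mp hsq)

/-- In characteristic three, five nonzero elements whose power sums of exponents `1`, `2`, `-1`
and `-2` vanish have a common fifth power. -/
theorem pow_five_eq_of_power_sums_eq_zero {F : Type*} [Field F] [CharP F 3] {a b c d e : F}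
    (ha : a ≠ 0) (hb : b ≠ 0) (hc : c ≠ 0) (hd : d ≠ 0) (he : e ≠ 0)
    (h1 : a + b + c + d + e = 0) (h2 : a ^ 2 + b ^ 2 + c ^ 2 + d ^ 2 + e ^ 2 = 0)
    (h1' : a⁻¹ + b⁻¹ + c⁻¹ + d⁻¹ + e⁻¹ = 0)
    (h2' : a⁻¹ ^ 2 + b⁻¹ ^ 2 + c⁻¹ ^ 2 + d⁻¹ ^ 2 + e⁻¹ ^ 2 = 0) : a ^ 5 = b ^ 5 := by
  have h3 : (3 : F) = 0 := by exact_mod_cast CharP.cast_eq_zero F 3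
  have esymm_two {a b c d e : F} (h1 : a + b + c + d + e = 0)
      (h2 : a ^ 2 + b ^ 2 + c ^ 2 + d ^ 2 + e ^ 2 = 0) :
      a * b + a * c + a * d + a * e + b * c + b * d + b * e + c * d + c * e + d * e = 0 := by
    linear_combination 2 * (a + b + c + d + e) * h1 - 2 * h2 -
      (a * b + a * c + a * d + a * e + b * c + b * d + b * e + c * d + c * e + d * e) * h3
  have s2 := esymm_two h1 h2
  have hinv := esymm_two h1' h2'
  have s4 : b * c * d * e + a * c * d * e + a * b * d * e + a * b * c * e + a * b * c * d = 0 := by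
    field_simp at h1'
    linear_combination h1'
  have s3 : c * d * e + b * d * e + b * c * e + b * c * d + a * d * e + a * c * e + a * c * d +
      a * b * e + a * b * d + a * b * c = 0 := by
    field_simp at hinv
    linear_combination hinv
  linear_combination (a ^ 4 - b ^ 4) * h1 - (a ^ 3 - b ^ 3) * s2 + (a ^ 2 - b ^ 2) * s3 -
    (a - b) * s4

/-- In characteristic three, five distinct nonzero elements with distinct fifth powers admit no
signs for which the signed power sums of exponents `1`, `2`, `-1` and `-2` all vanish. -/
theorem not_signed_power_sums_eq_zero {F : Type*} [Field F] [CharP F 3] {x j : Fin 5 → F}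
    (hx : ∀ t, x t ≠ 0) (hinj : Function.Injective fun t => x t ^ 5)
    (hj : ∀ t, j t = 1 ∨ j t = -1)
    (h1 : ∑ t, j t * x t = 0) (h2 : ∑ t, j t * x t ^ 2 = 0)
    (h1' : ∑ t, j t * (x t)⁻¹ = 0) (h2' : ∑ t, j t * (x t)⁻¹ ^ 2 = 0) : False := by
  classical
  have h3 : (3 : F) = 0 := by exact_mod_cast CharP.cast_eq_zero F 3
  have hxinj : Function.Injective x := fun s t hst => hinj (congrArg (· ^ 5) hst)
  have h0 : ∑ t, j t ≠ 0 := by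
    intro h0
    have hv := Matrix.eq_zero_of_forall_pow_sum_mul_pow_eq_zero
      (v := fun t => j t * (x t)⁻¹ ^ 2) hxinj (fun i => by
        fin_cases i
        · simpa using h2'
        · refine Eq.trans (Finset.sum_congr rfl fun t _ => ?_) h1'
          have := hx t
          simp only
          field_simp
        · refine Eq.trans (Finset.sum_congr rfl fun t _ => ?_) h0
          have := hx t
          simp only
          field_simp
        · refine Eq.trans (Finset.sum_congr rfl fun t _ => ?_) h1
          have := hx t
          simp only
          field_simp
        · refine Eq.trans (Finset.sum_congr rfl fun t _ => ?_) h2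
          have := hx t
          simp only
          field_simp)
    have := congrFun hv 0
    rcases hj 0 with h | h <;> simp [h, hx 0] at this
  obtain ⟨S, hS⟩ : ∃ S : Finset (Fin 5), ∀ t, j t = if t ∈ S then 1 else -1 := by
    refine ⟨Finset.univ.filter fun t => j t = 1, fun t => ?_⟩
    by_cases h : j t = 1
    · simp [h]
    · simp [(hj t).resolve_left h]
  have split (f : Fin 5 → F) : ∑ t, j t * f t = ∑ t ∈ S, f t - ∑ t ∈ Sᶜ, f t := by
    rw [← Finset.sum_add_sum_compl S, sub_eq_add_neg, ← Finset.sum_neg_distrib]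
    congr 1
    · exact Finset.sum_congr rfl fun t ht => by rw [hS, if_pos ht, one_mul]
    · exact Finset.sum_congr rfl fun t ht => by
        rw [hS, if_neg (Finset.mem_compl.mp ht), neg_one_mul]
  have key (T : Finset (Fin 5)) (hT : 3 ≤ T.card) (h0 : (T.card : F) - (Tᶜ.card : F) ≠ 0)
      (h1 : ∑ t ∈ T, x t = ∑ t ∈ Tᶜ, x t)
      (h2 : ∑ t ∈ T, x t ^ 2 = ∑ t ∈ Tᶜ, x t ^ 2)
      (h1' : ∑ t ∈ T, (x t)⁻¹ = ∑ t ∈ Tᶜ, (x t)⁻¹)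
      (h2' : ∑ t ∈ T, (x t)⁻¹ ^ 2 = ∑ t ∈ Tᶜ, (x t)⁻¹ ^ 2) : False := by
    have hc := Finset.card_add_card_compl T
    rw [Fintype.card_fin] at hc
    obtain hc3 | hc4 | hc5 : T.card = 3 ∨ T.card = 4 ∨ T.card = 5 := by omega
    · obtain ⟨a, b, c, hab, hac, hbc, hT3⟩ := Finset.card_eq_three.mp hc3
      obtain ⟨d, e, hde, hcompl⟩ := Finset.card_eq_two.mp (by omega : Tᶜ.card = 2)
      rw [hcompl, hT3] at h1 h2 h1' h2'
      have expand (f : Fin 5 → F) (h : ∑ t ∈ {a, b, c}, f t = ∑ t ∈ {d, e}, f t) :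
          f a + f b + f c = f d + f e := by
        rwa [Finset.sum_insert (by simp [hab, hac]), Finset.sum_pair hbc, Finset.sum_pair hde,
          ← add_assoc] at h
      exact hde (hxinj (eq_of_triple_pair_power_sums (hx a) (hx b) (hx c) (hx d) (hx e)
        (expand _ h1) (expand _ h2) (expand _ h1') (expand _ h2')))
    · apply h0
      rw [hc4, (by omega : Tᶜ.card = 1)]
      push_cast
      linear_combination h3
    · have hu : T = Finset.univ := by
        rw [← Finset.card_eq_iff_eq_univ, hc5, Fintype.card_fin]
      subst hu
      simp only [Finset.compl_univ, Finset.sum_empty, Fin.sum_univ_five] at h1 h2 h1' h2'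
      exact absurd (hinj (pow_five_eq_of_power_sums_eq_zero (hx 0) (hx 1) (hx 2) (hx 3) (hx 4)
        h1 h2 h1' h2')) (by decide)
  have h0 : (S.card : F) - (Sᶜ.card : F) ≠ 0 := by
    have := split fun _ => 1
    simp only [mul_one, Finset.sum_const, nsmul_eq_mul] at this
    rwa [← this]
  rw [split, sub_eq_zero] at h1 h2 h1' h2'
  by_cases hT : 3 ≤ S.card
  · exact key S hT h0 h1 h2 h1' h2'
  · have hc := Finset.card_add_card_compl S
    rw [Fintype.card_fin] at hc
    refine key Sᶜ (by omega) ?_ ?_ ?_ ?_ ?_ <;> rw [compl_compl]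
    · rwa [← neg_ne_zero, neg_sub]
    · exact h1.symm
    · exact h2.symm
    · exact h1'.symm
    · exact h2'.symm

/-- Signed power sums in characteristic three commute with iterated Frobenius. -/
theorem sum_sign_mul_pow_three_pow {F ι : Type*} [Field F] [CharP F 3] [Fintype ι]
    {j f : ι → F} (hj : ∀ t, j t = 1 ∨ j t = -1) (h : ∑ t, j t * f t = 0) (i : ℕ) :
    ∑ t, j t * f t ^ 3 ^ i = 0 := by
  have : Fact (Nat.Prime 3) := ⟨Nat.prime_three⟩
  have h' : (∑ t, j t * f t) ^ 3 ^ i = 0 := by rw [h, zero_pow (by positivity)]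
  rw [sum_pow_char_pow] at h'
  rw [← h']
  refine Finset.sum_congr rfl fun t _ => ?_
  have hodd : Odd (3 ^ i) := Odd.pow (by decide)
  rcases hj t with ht | ht <;> simp [ht, hodd.neg_pow]


theorem stmt_11 (m h : ℕ) (hm4 : 4 ≤ m) (hm : m % 4 = 0)
    (hgh : Nat.gcd h (3 ^ m + 1) ≤ 2) (hgh1 : Nat.gcd (h + 1) (3 ^ m + 1) ≤ 2)
    (hi : ∃ i : ℕ, i ≤ 2 * m - 1 ∧ (h + 1) * 3 ^ i ≡ 2 * h [MOD 3 ^ m + 1])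
    (F : Type*) [Field F] [Fintype F] (hF : Fintype.card F = 3 ^ (2 * m)) :
    ¬ ∃ u₁ u₂ u₃ u₄ u₅ : F,
      u₁ ≠ u₂ ∧ u₁ ≠ u₃ ∧ u₁ ≠ u₄ ∧ u₁ ≠ u₅ ∧ u₂ ≠ u₃ ∧ u₂ ≠ u₄ ∧ u₂ ≠ u₅ ∧
      u₃ ≠ u₄ ∧ u₃ ≠ u₅ ∧ u₄ ≠ u₅ ∧
      u₁ ^ (3 ^ m + 1) = 1 ∧ u₂ ^ (3 ^ m + 1) = 1 ∧ u₃ ^ (3 ^ m + 1) = 1 ∧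
      u₄ ^ (3 ^ m + 1) = 1 ∧ u₅ ^ (3 ^ m + 1) = 1 ∧
      ∃ j₁ j₂ j₃ j₄ j₅ : F,
        (j₁ = 1 ∨ j₁ = -1) ∧ (j₂ = 1 ∨ j₂ = -1) ∧ (j₃ = 1 ∨ j₃ = -1) ∧
        (j₄ = 1 ∨ j₄ = -1) ∧ (j₅ = 1 ∨ j₅ = -1) ∧
        j₁ * u₁ ^ h + j₂ * u₂ ^ h + j₃ * u₃ ^ h + j₄ * u₄ ^ h + j₅ * u₅ ^ h = 0 ∧
        j₁ * u₁ ^ (h + 1) + j₂ * u₂ ^ (h + 1) + j₃ * u₃ ^ (h + 1) +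
          j₄ * u₄ ^ (h + 1) + j₅ * u₅ ^ (h + 1) = 0 := by
  rintro ⟨u₁, u₂, u₃, u₄, u₅, h12, h13, h14, h15, h23, h24, h25, h34, h35, h45,
    hu1, hu2, hu3, hu4, hu5, j₁, j₂, j₃, j₄, j₅, hj1, hj2, hj3, hj4, hj5, hs, hs'⟩
  obtain ⟨i, -, hi⟩ := hi
  have : Fact (Nat.Prime 3) := ⟨Nat.prime_three⟩
  have : CharP F 3 := charP_of_card_eq_prime_pow hF
  have hN : 2 ∣ 3 ^ m + 1 := (Odd.add_one (Odd.pow (by decide))).two_dvd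
  have hodd : Odd h := by
    have h2 : Even ((h + 1) * 3 ^ i) := by
      rw [Nat.even_iff]
      have := hi.of_dvd hN
      rw [Nat.ModEq] at this
      omega
    rw [Nat.even_mul, Nat.even_add_one, Nat.not_even_iff_odd] at h2
    exact h2.resolve_right (Nat.not_even_iff_odd.mpr (Odd.pow (by decide)))
  have hcop : h.Coprime (3 ^ m + 1) := by
    have hg : Odd (h.gcd (3 ^ m + 1)) := Odd.of_dvd_nat hodd (Nat.gcd_dvd_left _ _)
    obtain ⟨k, hk⟩ := hg
    rw [Nat.Coprime]
    omega
  have hcop5 : Nat.Coprime 5 (3 ^ m + 1) := by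
    obtain ⟨k, rfl⟩ : 4 ∣ m := Nat.dvd_of_mod_eq_zero hm
    have : 3 ^ (4 * k) ≡ 1 [MOD 5] := by
      rw [pow_mul]
      simpa using (show 3 ^ 4 ≡ 1 [MOD 5] by decide).pow k
    rw [Nat.Prime.coprime_iff_not_dvd Nat.prime_five]
    rw [Nat.ModEq] at this
    omega
  let u : Fin 5 → F := ![u₁, u₂, u₃, u₄, u₅]
  let j : Fin 5 → F := ![j₁, j₂, j₃, j₄, j₅]
  have hj : ∀ t, j t = 1 ∨ j t = -1 := by
    simp [j, Fin.forall_fin_succ, hj1, hj2, hj3, hj4, hj5]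
  have hu : ∀ t, u t ^ (3 ^ m + 1) = 1 := by
    simp [u, Fin.forall_fin_succ, hu1, hu2, hu3, hu4, hu5]
  have huinj : Function.Injective u := by
    intro s t
    fin_cases s <;> fin_cases t <;> simp [u, *, Ne.symm, eq_comm]
  have hsum : ∑ t, j t * u t ^ h = 0 := by
    simpa [Fin.sum_univ_five, j, u] using hs
  have hsum' : ∑ t, j t * u t ^ (h + 1) = 0 := by
    simpa [Fin.sum_univ_five, j, u] using hs'
  have hu0 (t : Fin 5) : u t ≠ 0 := by
    intro h0
    simpa [h0] using hu t
  have hpow (n : ℕ) (t : Fin 5) : (u t ^ n) ^ (3 ^ m + 1) = 1 := by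
    rw [← pow_mul, mul_comm, pow_mul, hu, one_pow]
  have hconj (n : ℕ) (t : Fin 5) : (u t ^ n) ^ 3 ^ m = (u t ^ n)⁻¹ :=
    eq_inv_of_mul_eq_one_left (by rw [← pow_succ, hpow])
  have hsq : ∑ t, j t * u t ^ (h * 2) = 0 := by
    rw [← sum_sign_mul_pow_three_pow hj hsum' i]
    refine Finset.sum_congr rfl fun t _ => ?_
    rw [← pow_mul, mul_comm h, ← pow_eq_pow_of_modEq hi (hu t)]
  refine not_signed_power_sums_eq_zero (x := fun t => u t ^ h) (j := j)
    (fun t => pow_ne_zero _ (hu0 t)) (fun s t hst => huinj ?_) hj hsum ?_ ?_ ?_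
  · exact eq_of_pow_eq_of_coprime hcop (hu0 t) (hu s) (hu t)
      (eq_of_pow_eq_of_coprime hcop5 (pow_ne_zero _ (hu0 t)) (hpow h s) (hpow h t) hst)
  · simpa only [← pow_mul] using hsq
  · simpa only [hconj] using sum_sign_mul_pow_three_pow hj hsum m
  · have hsq' := sum_sign_mul_pow_three_pow hj hsq m
    simp only [hconj] at hsq'
    simpa only [inv_pow, ← pow_mul] using hsq'
end

section
/- Let m ≥ 2 be even, let h ≥ 1 be an integer with gcd(h, 2^m+1) = 1, and let F be a field of characteristic 2. If x, y, z ∈ F are pairwise distinct, each different from 1, and satisfy x^{2^m+1} = y^{2^m+1} = z^{2^m+1} = 1, then 1 + x^h + y^h + z^h ≠ 0. -/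
theorem eq_one_of_pow_eq_one_of_gcd_eq_one {M : Type*} [Monoid M] {a : M} {k n : ℕ}
    (hkn : Nat.gcd k n = 1) (hk : a ^ k = 1) (hn : a ^ n = 1) : a = 1 := by
  have h := Nat.dvd_gcd (orderOf_dvd_of_pow_eq_one hk) (orderOf_dvd_of_pow_eq_one hn)
  rwa [hkn, Nat.dvd_one, orderOf_eq_one_iff] at h

/-- In characteristic 2, four elements of the unit circle `U_{2^m+1}`, one of which is `1`,
can sum to zero only if another one is `1`. -/
theorem eq_one_or_of_one_add_add_add_eq_zero {F : Type*} [Field F] [CharP F 2] {m : ℕ} {a b c : F}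
    (ha : a ^ (2 ^ m + 1) = 1) (hb : b ^ (2 ^ m + 1) = 1) (hc : c ^ (2 ^ m + 1) = 1)
    (h : 1 + a + b + c = 0) : a = 1 ∨ b = 1 ∨ c = 1 := by
  have hconj : 1 + a ^ 2 ^ m + b ^ 2 ^ m + c ^ 2 ^ m = 0 := by
    have := congrArg (· ^ 2 ^ m) h
    simpa [add_pow_char_pow] using this
  rw [pow_succ] at ha hb hc
  have hsymm : a * b * c + b * c + a * c + a * b = 0 := by
    linear_combination (a * b * c) * hconj - b * c * ha - a * c * hb - a * b * hc
  have hprod : (a + 1) * (b + 1) * (c + 1) = 0 := by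
    linear_combination h + hsymm
  simpa [← CharTwo.sub_eq_add, sub_eq_zero, or_assoc] using hprod

theorem stmt_12 (m h : ℕ) (hm : Even m) (hm2 : 2 ≤ m) (hh : 1 ≤ h)
    (hgcd : Nat.gcd h (2 ^ m + 1) = 1)
    (F : Type*) [Field F] [CharP F 2]
    (x y z : F) (hxy : x ≠ y) (hxz : x ≠ z) (hyz : y ≠ z)
    (hx1 : x ≠ 1) (hy1 : y ≠ 1) (hz1 : z ≠ 1)
    (hx : x ^ (2 ^ m + 1) = 1) (hy : y ^ (2 ^ m + 1) = 1) (hz : z ^ (2 ^ m + 1) = 1) :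
    1 + x ^ h + y ^ h + z ^ h ≠ 0 := by
  intro hsum
  have hpow {a : F} (ha : a ^ (2 ^ m + 1) = 1) : (a ^ h) ^ (2 ^ m + 1) = 1 := by
    rw [pow_right_comm, ha, one_pow]
  rcases eq_one_or_of_one_add_add_add_eq_zero (hpow hx) (hpow hy) (hpow hz) hsum with h1 | h1 | h1
  · exact hx1 (eq_one_of_pow_eq_one_of_gcd_eq_one hgcd h1 hx)
  · exact hy1 (eq_one_of_pow_eq_one_of_gcd_eq_one hgcd h1 hy)
  · exact hz1 (eq_one_of_pow_eq_one_of_gcd_eq_one hgcd h1 hz)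
end

section
/- Let F be a field of characteristic 2 containing an element of multiplicative order 257. Then there exist five pairwise distinct elements u_1, u_2, u_3, u_4, u_5 ∈ F with u_t^{257} = 1 for all t and u_1 + u_2 + u_3 + u_4 + u_5 = 0. -/
theorem pow_eq_one_of_pentanomial_eq_zero {R : Type*} [CommRing R] [CharP R 2] (x : R)
    (hx : x ^ 16 + x ^ 15 + x ^ 8 + x + 1 = 0) : x ^ 257 = 1 := by
  have h16 : x ^ 16 = 1 + x + x ^ 8 + x ^ 15 := by
    linear_combination (norm := (ring_nf; reduce_mod_char!)) hx
  have h32 : x ^ 32 = x ^ 3 + x ^ 4 + x ^ 5 + x ^ 6 + x ^ 7 + x ^ 8 + x ^ 9 + x ^ 11 + x ^ 13 +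
      x ^ 15 := by
    linear_combination (norm := (ring_nf; reduce_mod_char!)) (x ^ 16 + (1 + x + x ^ 8 +
        x ^ 15)) * h16 + (1 + x + x ^ 3 + x ^ 5 + x ^ 7 + x ^ 8 + x ^ 9 + x ^ 10 + x ^ 11 +
        x ^ 12 + x ^ 13 + x ^ 14) * hx
  have h64 : x ^ 64 = 1 + x + x ^ 3 + x ^ 4 + x ^ 5 + x ^ 10 + x ^ 12 + x ^ 13 + x ^ 14 := by
    linear_combination (norm := (ring_nf; reduce_mod_char!)) (x ^ 32 + (x ^ 3 + x ^ 4 + x ^ 5 +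
        x ^ 6 + x ^ 7 + x ^ 8 + x ^ 9 + x ^ 11 + x ^ 13 + x ^ 15)) * h32 + (1 + x ^ 3 + x ^ 5 +
        x ^ 11 + x ^ 12 + x ^ 13 + x ^ 14) * hx
  have h128 : x ^ 128 = x + x ^ 2 + x ^ 4 + x ^ 6 + x ^ 9 + x ^ 10 + x ^ 11 + x ^ 12 + x ^ 14 := by
    linear_combination (norm := (ring_nf; reduce_mod_char!)) (x ^ 64 + (1 + x + x ^ 3 + x ^ 4 +
        x ^ 5 + x ^ 10 + x ^ 12 + x ^ 13 + x ^ 14)) * h64 + (1 + x ^ 4 + x ^ 5 + x ^ 6 + x ^ 7 +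
        x ^ 8 + x ^ 11 + x ^ 12) * hx
  have h256 : x ^ 256 = 1 + x ^ 7 + x ^ 14 + x ^ 15 := by
    linear_combination (norm := (ring_nf; reduce_mod_char!)) (x ^ 128 + (x + x ^ 2 + x ^ 4 +
        x ^ 6 + x ^ 9 + x ^ 10 + x ^ 11 + x ^ 12 + x ^ 14)) * h128 + (1 + x + x ^ 4 + x ^ 5 +
        x ^ 6 + x ^ 9 + x ^ 10 + x ^ 11 + x ^ 12) * hx
  linear_combination (norm := (ring_nf; reduce_mod_char!)) x * h256 + hx

theorem exists_pentanomial_root_of_orderOf_eq (F : Type*) [Field F] [CharP F 2]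
    (g : F) (hg : orderOf g = 257) : ∃ x : F, x ^ 16 + x ^ 15 + x ^ 8 + x + 1 = 0 := by
  let K := AlgebraicClosure F
  have : CharP K 2 := charP_of_injective_algebraMap (algebraMap F K).injective 2
  let f : Polynomial K := .X ^ 16 + .X ^ 15 + .X ^ 8 + .X + 1
  have hf : f.degree = 16 := by
    unfold f
    compute_degree!
  obtain ⟨x, hx⟩ := IsAlgClosed.exists_root f (by simp [hf])
  have hx : x ^ 16 + x ^ 15 + x ^ 8 + x + 1 = 0 := by simpa [f] using hx
  have hprim : IsPrimitiveRoot (algebraMap F K g) 257 :=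
    (hg ▸ IsPrimitiveRoot.orderOf g).map_of_injective (algebraMap F K).injective
  obtain ⟨i, -, rfl⟩ := hprim.eq_pow_of_pow_eq_one (pow_eq_one_of_pentanomial_eq_zero x hx)
  refine ⟨g ^ i, (algebraMap F K).injective ?_⟩
  simpa using hx

theorem stmt_14 (F : Type*) [Field F] [CharP F 2]
    (g : F) (hg : orderOf g = 257) :
    ∃ u₁ u₂ u₃ u₄ u₅ : F,
      u₁ ≠ u₂ ∧ u₁ ≠ u₃ ∧ u₁ ≠ u₄ ∧ u₁ ≠ u₅ ∧ u₂ ≠ u₃ ∧ u₂ ≠ u₄ ∧ u₂ ≠ u₅ ∧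
      u₃ ≠ u₄ ∧ u₃ ≠ u₅ ∧ u₄ ≠ u₅ ∧
      u₁ ^ (257 : ℕ) = 1 ∧ u₂ ^ (257 : ℕ) = 1 ∧ u₃ ^ (257 : ℕ) = 1 ∧
      u₄ ^ (257 : ℕ) = 1 ∧ u₅ ^ (257 : ℕ) = 1 ∧
      u₁ + u₂ + u₃ + u₄ + u₅ = 0 := by
  obtain ⟨x, hx⟩ := exists_pentanomial_root_of_orderOf_eq F g hg
  have hx257 := pow_eq_one_of_pentanomial_eq_zero x hx
  have hx1 : x ≠ 1 := by
    rintro rfl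
    apply one_ne_zero (α := F)
    linear_combination hx - 2 * CharTwo.two_eq_zero (R := F)
  have : Fact (Nat.Prime 257) := ⟨by norm_num⟩
  have hord : orderOf x = 257 := orderOf_eq_prime hx257 hx1
  have hne (i j : ℕ) (hi : i < 257) (hj : j < 257) (hij : i ≠ j) : x ^ i ≠ x ^ j := fun h ↦
    hij (pow_injOn_Iio_orderOf (by simpa [hord] using hi) (by simpa [hord] using hj) h)
  have hroot (i : ℕ) : (x ^ i) ^ 257 = 1 := by rw [pow_right_comm, hx257, one_pow]
  refine ⟨x ^ 16, x ^ 15, x ^ 8, x ^ 1, x ^ 0, ?_, ?_, ?_, ?_, ?_, ?_, ?_, ?_, ?_, ?_,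
    hroot _, hroot _, hroot _, hroot _, hroot _, by simpa using hx⟩
  all_goals exact hne _ _ (by norm_num) (by norm_num) (by norm_num)
end

section
/- Let s ≥ 1, m ≥ 2, and i be integers with 0 < i < s·m and gcd(i, s·m) = 1, and let ℓ be an integer with 1 ≤ ℓ ≤ 2m−1 and ℓ ∣ 2m. If (2^{sm} + 1) divides (2^i + 1)·(2^{sℓ} − 1), then s = 1, m = 3, i = 1 and ℓ = 2. -/
theorem gcd_two_pow_add_one_dvd_three {a b : ℕ} (h : Nat.gcd a b = 1) :
    Nat.gcd (2 ^ a + 1) (2 ^ b + 1) ∣ 3 := by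
  have key : ∀ c : ℕ, 2 ^ c + 1 ∣ 2 ^ (2 * c) - 1 := fun c =>
    ⟨2 ^ c - 1, by rw [mul_comm 2 c, pow_mul]; simpa using Nat.sq_sub_sq (2 ^ c) 1⟩
  have h3 := Nat.pow_sub_one_gcd_pow_sub_one 2 (2 * a) (2 * b)
  rw [Nat.gcd_mul_left, h] at h3
  have hd := Nat.gcd_dvd_gcd_of_dvd_left (2 ^ b + 1) (key a)
  have hd' := Nat.gcd_dvd_gcd_of_dvd_right (2 ^ (2 * a) - 1) (key b)
  simpa [h3] using hd.trans hd'

theorem not_two_pow_add_one_dvd_of_dvd {n i L : ℕ} (hi : i < n) (hL : L ∣ n) :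
    ¬ 2 ^ n + 1 ∣ (2 ^ i + 1) * (2 ^ L - 1) := by
  intro h
  have h1 : 2 ^ n + 1 ∣ (2 ^ i + 1) * (2 ^ n - 1) :=
    h.trans (mul_dvd_mul_left _ (Nat.pow_sub_one_dvd_pow_sub_one 2 hL))
  have hcop : Nat.Coprime (2 ^ n + 1) (2 ^ n - 1) := by
    have hn : 1 ≤ 2 ^ n := Nat.one_le_two_pow
    have hodd : Odd (2 ^ n + 1) :=
      Even.add_one ((Nat.even_pow.2 ⟨even_two, by omega⟩))
    have h2 : Nat.gcd (2 ^ n + 1) (2 ^ n - 1) ∣ 2 := by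
      have := Nat.dvd_sub (Nat.gcd_dvd_left (2 ^ n + 1) (2 ^ n - 1))
        (Nat.gcd_dvd_right (2 ^ n + 1) (2 ^ n - 1))
      rwa [show 2 ^ n + 1 - (2 ^ n - 1) = 2 by omega] at this
    exact Nat.eq_one_of_dvd_coprimes (Nat.coprime_two_right.2 hodd) (Nat.gcd_dvd_left _ _) h2
  have hle := Nat.le_of_dvd (by positivity) (hcop.dvd_of_dvd_mul_right h1)
  have hlt : 2 ^ i < 2 ^ n := Nat.pow_lt_pow_right (by norm_num) hi
  omega

theorem eq_one_and_eq_three_of_two_pow_add_one_dvd {d k : ℕ} (hd : 1 ≤ d) (hk : 3 ≤ k)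
    (h : 2 ^ (d * k) + 1 ∣ 3 * (2 ^ (2 * d) - 1)) : d = 1 ∧ k = 3 := by
  have hpos : 2 ^ 2 ≤ 2 ^ (2 * d) := Nat.pow_le_pow_right (by norm_num) (by omega)
  have hle := Nat.le_of_dvd (by omega) h
  have h3 : 2 ^ (d * 3) ≤ 2 ^ (d * k) :=
    Nat.pow_le_pow_right (by norm_num) (Nat.mul_le_mul_left d hk)
  have hd1 : d = 1 := by
    by_contra hne
    have h4 : 2 ^ 2 ≤ 2 ^ d := Nat.pow_le_pow_right (by norm_num) (by omega)
    have h5 : 2 ^ (d * 3) = 2 ^ d * 2 ^ (2 * d) := by rw [← pow_add]; congr 1; ring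
    have h6 := Nat.mul_le_mul_right (2 ^ (2 * d)) h4
    omega
  subst hd1
  refine ⟨rfl, ?_⟩
  by_contra hne
  have : 2 ^ 4 ≤ 2 ^ (1 * k) := Nat.pow_le_pow_right (by norm_num) (by omega)
  omega

theorem stmt_15 (s m i ℓ : ℕ) (hs : 1 ≤ s) (hm : 2 ≤ m)
    (hi0 : 0 < i) (hi : i < s * m) (hgcd : Nat.gcd i (s * m) = 1)
    (hℓ1 : 1 ≤ ℓ) (hℓ2 : ℓ ≤ 2 * m - 1) (hℓd : ℓ ∣ 2 * m)
    (hdvd : (2 ^ (s * m) + 1) ∣ (2 ^ i + 1) * (2 ^ (s * ℓ) - 1)) :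
    s = 1 ∧ m = 3 ∧ i = 1 ∧ ℓ = 2 := by
  obtain ⟨k, hk⟩ := hℓd
  rcases Nat.even_or_odd' k with ⟨c, rfl | rfl⟩
  · have hmc : m = ℓ * c := by linarith
    exact absurd hdvd (not_two_pow_add_one_dvd_of_dvd hi (mul_dvd_mul_left s ⟨c, hmc⟩))
  have hc : c ≠ 0 := by rintro rfl; omega
  obtain ⟨d, rfl⟩ : 2 ∣ ℓ :=
    Nat.Coprime.dvd_of_dvd_mul_right (by simp) (Dvd.intro m hk)
  have hmd : m = d * (2 * c + 1) := by linarith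
  have h3 : 2 ^ (s * m) + 1 ∣ 3 * (2 ^ (s * (2 * d)) - 1) := by
    rw [Nat.dvd_mul] at hdvd
    obtain ⟨x, y, hx, hy, hxy⟩ := hdvd
    rw [← hxy]
    refine mul_dvd_mul ((Nat.dvd_gcd hx ?_).trans (gcd_two_pow_add_one_dvd_three hgcd)) hy
    exact Dvd.intro y hxy
  rw [show s * m = s * d * (2 * c + 1) by rw [hmd]; ring,
    show s * (2 * d) = 2 * (s * d) by ring] at h3
  obtain ⟨hsd, hc3⟩ := eq_one_and_eq_three_of_two_pow_add_one_dvd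
    (Nat.mul_pos hs (by omega)) (by omega) h3
  obtain ⟨rfl, rfl⟩ := mul_eq_one.1 hsd
  obtain rfl : c = 1 := by omega
  subst hmd
  refine ⟨rfl, rfl, ?_, rfl⟩
  norm_num at hi
  interval_cases i
  · rfl
  · norm_num at hdvd
end

section
/- Let s ≥ 1, m ≥ 2, and i be integers with 0 < i < s·m and gcd(i, s·m) = 1, and let ℓ be an integer with 1 ≤ ℓ ≤ 2m−1 and ℓ ∣ 2m. If (2^{sm} + 1) divides (2^i − 1)·(2^{sℓ} − 1), then s = 1, m = 3, i = 2 and ℓ = 2. -/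
theorem gcd_two_pow_add_one_two_pow_sub_one_dvd_three {n i : ℕ} (h : Nat.Coprime i n) :
    Nat.gcd (2 ^ n + 1) (2 ^ i - 1) ∣ 3 := by
  have h1 : 2 ^ n + 1 ∣ 2 ^ (2 * n) - 1 := by
    refine ⟨2 ^ n - 1, ?_⟩
    rw [mul_comm 2 n, pow_mul]
    simpa using Nat.sq_sub_sq (2 ^ n) 1
  have h2 : Nat.gcd (2 * n) i ∣ 2 := by
    rw [Nat.Coprime.gcd_mul_right_cancel 2 h.symm]
    exact Nat.gcd_dvd_left 2 i
  refine (Nat.gcd_dvd_gcd_of_dvd_left _ h1).trans ?_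
  rw [Nat.pow_sub_one_gcd_pow_sub_one]
  exact Nat.pow_sub_one_dvd_pow_sub_one 2 h2

theorem coprime_two_pow_add_one_two_pow_sub_one {n : ℕ} (hn : n ≠ 0) :
    Nat.Coprime (2 ^ n + 1) (2 ^ n - 1) := by
  have hpos : 1 ≤ 2 ^ n := Nat.one_le_two_pow
  have hodd : Odd (2 ^ n - 1) :=
    Nat.Even.sub_odd hpos ((Nat.even_pow' hn).2 even_two) odd_one
  have h : 2 ^ n + 1 = 2 + (2 ^ n - 1) := by omega
  rw [h, Nat.coprime_add_self_left]
  exact (Nat.coprime_two_left).2 hodd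

theorem stmt_16 (s m i ℓ : ℕ) (hs : 1 ≤ s) (hm : 2 ≤ m)
    (hi0 : 0 < i) (hi : i < s * m) (hgcd : Nat.gcd i (s * m) = 1)
    (hℓ1 : 1 ≤ ℓ) (hℓ2 : ℓ ≤ 2 * m - 1) (hℓd : ℓ ∣ 2 * m)
    (hdvd : (2 ^ (s * m) + 1) ∣ (2 ^ i - 1) * (2 ^ (s * ℓ) - 1)) :
    s = 1 ∧ m = 3 ∧ i = 2 ∧ ℓ = 2 := by
  have hn : 2 ≤ s * m := by nlinarith
  have h3 : 2 ^ (s * m) + 1 ∣ 3 * (2 ^ (s * ℓ) - 1) :=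
    (Nat.dvd_gcd_mul_iff_dvd_mul.2 hdvd).trans
      (Nat.mul_dvd_mul_right (gcd_two_pow_add_one_two_pow_sub_one_dvd_three hgcd) _)
  have hcases : ℓ = m ∨ 3 * ℓ ≤ 2 * m := by
    obtain ⟨c, hc⟩ := hℓd
    rcases Nat.lt_or_ge c 3 with h | h
    · interval_cases c <;> omega
    · right
      nlinarith
  rcases hcases with rfl | hle
  · have hdvd3 := (coprime_two_pow_add_one_two_pow_sub_one (by omega)).dvd_of_dvd_mul_right h3
    have := Nat.le_of_dvd (by norm_num) hdvd3
    have : 2 ^ 2 ≤ 2 ^ (s * ℓ) := Nat.pow_le_pow_right (by norm_num) hn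
    omega
  · have hk : s * ℓ ≠ 0 := by positivity
    have hpos : 2 ≤ 2 ^ (s * ℓ) := Nat.le_self_pow hk 2
    have hbound := Nat.le_of_dvd (by omega) h3
    have hlt : 2 ^ (s * m) < 2 ^ (s * ℓ + 2) := by
      rw [pow_add]
      omega
    have hexp := (Nat.pow_lt_pow_iff_right (by norm_num)).1 hlt
    have hsle : 3 * (s * ℓ) ≤ 2 * (s * m) := by nlinarith
    have hn3 : s * m ≤ 3 := by omega
    have hm3 : m ≤ 3 := by nlinarith
    have hs1 : s = 1 := by nlinarith
    subst hs1
    have hℓ3 : ℓ ≤ 2 := by omega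
    interval_cases m <;> interval_cases ℓ <;> interval_cases i <;> simp_all
end

section
/- Let s ≥ 1, m ≥ 2, and i be integers with 0 < i < s·m and gcd(i, s·m) = 1. If there exists an integer j with 1 ≤ j ≤ 2m−1 such that (2^{sm} + 1) divides (2^i + 1)·(2^{sj} − 1) + 2, then s = 1, m = 2 and i = 1. -/
lemma two_mul_pow_le_pow {a b : ℕ} (h : a < b) : 2 * (2 : ℤ) ^ a ≤ 2 ^ b := by
  rw [← pow_succ']
  exact pow_le_pow_right₀ (by norm_num) h

lemma not_dvd_two_pow_add_of_pos {n i k : ℕ} (hi0 : 0 < i) (hi : i < n) (hk0 : 0 < k)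
    (hk : k < n) : ¬ (2 : ℤ) ^ n + 1 ∣ 2 ^ (i + k) + 2 ^ k + 2 ^ i - 1 := by
  intro h
  have hi2 := two_mul_pow_le_pow hi0
  have hk2 := two_mul_pow_le_pow hk0
  have hin := two_mul_pow_le_pow hi
  have hkn := two_mul_pow_le_pow hk
  rw [pow_zero] at hi2 hk2
  rcases lt_or_ge (i + k) n with hik | hik
  · have hikn := two_mul_pow_le_pow hik
    rw [pow_add] at h hikn
    have := Int.le_of_dvd (by nlinarith) h
    nlinarith
  · obtain ⟨t, ht⟩ := Nat.exists_eq_add_of_le hik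
    have hti := two_mul_pow_le_pow (show t < i by omega)
    have htk := two_mul_pow_le_pow (show t < k by omega)
    have ht0 : (0 : ℤ) < 2 ^ t := by positivity
    have h' : (2 : ℤ) ^ n + 1 ∣ 2 ^ k + 2 ^ i - 2 ^ t - 1 := by
      have := h.sub (Dvd.intro ((2 : ℤ) ^ t) rfl)
      rw [ht, pow_add] at this
      exact this.trans (dvd_of_eq (by ring))
    have := Int.le_of_dvd (by linarith) h'
    linarith

lemma eq_of_dvd_two_pow_add_sub {n i k : ℕ} (hi0 : 0 < i) (hi : i < n) (hk0 : 0 < k)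
    (hk : k < n) (h : (2 : ℤ) ^ n + 1 ∣ 2 ^ (i + k) + 2 ^ k - 2 ^ i + 1) :
    i = k ∧ n = 2 * i := by
  have hi2 := two_mul_pow_le_pow hi0
  have hk2 := two_mul_pow_le_pow hk0
  have hin := two_mul_pow_le_pow hi
  have hkn := two_mul_pow_le_pow hk
  rw [pow_zero] at hi2 hk2
  rcases lt_or_ge (i + k) n with hik | hik
  · have hikn := two_mul_pow_le_pow hik
    rw [pow_add] at h hikn
    have := Int.le_of_dvd (by nlinarith) h
    nlinarith
  · obtain ⟨t, ht⟩ := Nat.exists_eq_add_of_le hik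
    have hti := two_mul_pow_le_pow (show t < i by omega)
    have htk := two_mul_pow_le_pow (show t < k by omega)
    have ht0 : (0 : ℤ) < 2 ^ t := by positivity
    have h' : (2 : ℤ) ^ n + 1 ∣ 2 ^ k - 2 ^ i - 2 ^ t + 1 := by
      have := h.sub (Dvd.intro ((2 : ℤ) ^ t) rfl)
      rw [ht, pow_add] at this
      exact this.trans (dvd_of_eq (by ring))
    have h0 := Int.eq_zero_of_abs_lt_dvd h' (abs_lt.2 ⟨by linarith, by linarith⟩)
    rcases Nat.eq_zero_or_pos t with rfl | htpos
    · have hki : (2 : ℤ) ^ i = 2 ^ k := by rw [pow_zero] at h0; linarith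
      have := pow_right_injective₀ (by norm_num : (0 : ℤ) < 2) (by norm_num) hki
      omega
    · have e1 := dvd_pow_self (2 : ℤ) hi0.ne'
      have e2 := dvd_pow_self (2 : ℤ) hk0.ne'
      have e3 := dvd_pow_self (2 : ℤ) htpos.ne'
      omega

lemma not_two_pow_add_one_dvd_two_pow {n : ℕ} (hn : 0 < n) (r : ℕ) :
    ¬ (2 : ℤ) ^ n + 1 ∣ 2 ^ r := by
  intro h
  have hodd : IsCoprime ((2 : ℤ) ^ n + 1) (2 ^ r) := by
    refine IsCoprime.pow_right ⟨1, -2 ^ (n - 1), ?_⟩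
    obtain ⟨l, rfl⟩ := Nat.exists_eq_add_of_lt hn
    simp [pow_succ]
  have hu := Int.isUnit_iff.1 (hodd.isUnit_of_dvd' dvd_rfl h)
  have : (0 : ℤ) < 2 ^ n := by positivity
  omega

theorem stmt_17 (s m i : ℕ) (hs : 1 ≤ s) (hm : 2 ≤ m)
    (hi0 : 0 < i) (hi : i < s * m) (hgcd : Nat.gcd i (s * m) = 1)
    (hj : ∃ j : ℕ, 1 ≤ j ∧ j ≤ 2 * m - 1 ∧
      (2 ^ (s * m) + 1) ∣ (2 ^ i + 1) * (2 ^ (s * j) - 1) + 2) :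
    s = 1 ∧ m = 2 ∧ i = 1 := by
  obtain ⟨j, hj1, hj2, hdvd⟩ := hj
  have hJ0 : 0 < s * j := by positivity
  have hJ : s * j < s * m + s * m := by
    rw [← mul_add]
    exact Nat.mul_lt_mul_of_pos_left (by omega) hs
  have hd : (2 : ℤ) ^ (s * m) + 1 ∣ (2 ^ i + 1) * (2 ^ (s * j) - 1) + 2 := by
    have := Int.natCast_dvd_natCast.2 hdvd
    push_cast [Nat.one_le_two_pow] at this
    exact this
  rcases lt_trichotomy (s * j) (s * m) with hlt | heq | hgt
  · obtain ⟨-, hn⟩ := eq_of_dvd_two_pow_add_sub hi0 hi hJ0 hlt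
      (by convert hd using 1; rw [pow_add]; ring)
    rw [hn, Nat.gcd_mul_left_right] at hgcd
    subst hgcd
    have hs1 : s = 1 := by nlinarith
    subst hs1
    omega
  · refine absurd ?_ (not_two_pow_add_one_dvd_two_pow (hi0.trans hi) (i + 1))
    have := (Dvd.intro ((2 : ℤ) ^ i + 1) rfl).sub hd
    rw [heq] at this
    exact this.trans (dvd_of_eq (by ring))
  · obtain ⟨k, hk⟩ := Nat.exists_eq_add_of_le hgt.le
    refine absurd ?_ (not_dvd_two_pow_add_of_pos hi0 hi
      (show 0 < k by omega) (show k < s * m by omega))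
    have := (Dvd.intro ((2 ^ i + 1) * (2 : ℤ) ^ k) rfl).sub hd
    rw [hk, pow_add] at this
    exact this.trans (dvd_of_eq (by ring))
end

section
/- Let q = 2^s with s ≥ 1, let m ≥ 1 be odd, let i be an integer with 1 ≤ i ≤ 2m−1 such that gcd(q^i − 1, q^m + 1) = 1, and let h be an integer with 0 ≤ h ≤ q^m satisfying h·(q^i − 1) ≡ 1 (mod q^m + 1). Then i is odd and (q + 1) divides 2h + 1. -/
theorem Nat.add_one_dvd_pow_sub_one_of_even (q : ℕ) {i : ℕ} (hi : Even i) :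
    q + 1 ∣ q ^ i - 1 := by
  obtain ⟨k, rfl⟩ := hi.two_dvd
  have h₁ : q ^ 2 - 1 ∣ q ^ (2 * k) - 1 := by
    simpa [pow_mul] using Nat.sub_dvd_pow_sub_pow (q ^ 2) 1 k
  have h₂ : q + 1 ∣ q ^ 2 - 1 := ⟨q - 1, by simpa using Nat.sq_sub_sq q 1⟩
  exact h₂.trans h₁

theorem Nat.add_one_dvd_pow_add_one_of_odd (q : ℕ) {m : ℕ} (hm : Odd m) :
    q + 1 ∣ q ^ m + 1 := by
  simpa using hm.nat_add_dvd_pow_add_pow q 1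

theorem stmt_18 (s m i h q : ℕ) (hs : 1 ≤ s) (hq : q = 2 ^ s) (hm : Odd m) (hm1 : 1 ≤ m)
    (hi1 : 1 ≤ i) (hi2 : i ≤ 2 * m - 1) (hgcd : Nat.gcd (q ^ i - 1) (q ^ m + 1) = 1)
    (hh : h ≤ q ^ m) (hhi : h * (q ^ i - 1) ≡ 1 [MOD q ^ m + 1]) :
    Odd i ∧ (q + 1) ∣ (2 * h + 1) := by
  have hq0 : 0 < q := hq ▸ Nat.two_pow_pos s
  have hqm := Nat.add_one_dvd_pow_add_one_of_odd q hm
  have hi : Odd i := by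
    by_contra hi
    have hdvd := Nat.dvd_gcd
      (Nat.add_one_dvd_pow_sub_one_of_even q (Nat.not_odd_iff_even.mp hi)) hqm
    rw [hgcd, Nat.dvd_one] at hdvd
    omega
  refine ⟨hi, ?_⟩
  have hqi : ((q + 1 : ℕ) : ℤ) ∣ ((q ^ i + 1 : ℕ) : ℤ) :=
    Int.natCast_dvd_natCast.mpr (Nat.add_one_dvd_pow_add_one_of_odd q hi)
  have hmod := (hhi.of_dvd hqm).dvd
  rw [← Int.natCast_dvd_natCast]
  have hsum : ((2 * h + 1 : ℕ) : ℤ) =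
      ((1 : ℕ) - (h * (q ^ i - 1) : ℕ) : ℤ) + h * (q ^ i + 1 : ℕ) := by
    push_cast [Nat.one_le_pow i q hq0]
    ring
  rw [hsum]
  exact dvd_add hmod (hqi.mul_left (h : ℤ))
end
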